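/- Full reconstruction for n = 2 (Theorem 2). Under the random features setup and the data, activation, and scaling assumptions, with n = 2: for every η > 0 and every k > 0 there exists D such that for all d ≥ D, with probability at least 1 − d^{−k} over the random features matrix V and the training data x_1, x_2, the following holds simultaneously for every matrix X̂ ∈ ℝ^{2×d} whose rows x̂_1, x̂_2 satisfy ‖x̂_j‖_2 = √d for j ∈ {1, 2} and such that φ(x_i) ∈ span{φ(x̂_1), φ(x̂_2)} for every i ∈ {1, 2}: for every i ∈ {1, 2} there exists ĵ ∈ {1, 2} with ‖x̂_ĵ − x_i‖_2 ≤ η √d. -/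

import Mathlib

open MeasureTheory ProbabilityTheory Filter

noncomputable section

/-- Euclidean (ℓ²) norm of a vector in `Fin m → ℝ`. -/
def eNorm {m : ℕ} (x : Fin m → ℝ) : ℝ := Real.sqrt (∑ j, (x j) ^ 2)

/-- Euclidean dot product. -/
def dotp {m : ℕ} (u v : Fin m → ℝ) : ℝ := ∑ j, u j * v j

/-- The random-features map `x ↦ (φ(vₖᵀx))ₖ`, where `vₖ` is the `k`-th row of `V`. -/
def featureMap {p d : ℕ} (φ : ℝ → ℝ) (V : Fin p → Fin d → ℝ) (x : Fin d → ℝ) :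
    Fin p → ℝ := fun k => φ (dotp (V k) x)

/-- The `l`-th normalized probabilists' Hermite polynomial (orthonormal in `L²(N(0,1))`). -/
def hermiteFn (l : ℕ) (x : ℝ) : ℝ :=
  (Polynomial.aeval x (Polynomial.hermite l)) / Real.sqrt (Nat.factorial l)

/-- The `l`-th Hermite coefficient `μ_l` of `φ`. -/
def hermiteCoeff (φ : ℝ → ℝ) (l : ℕ) : ℝ :=
  ∫ g, φ g * hermiteFn l g ∂(gaussianReal 0 1)

/-- The nonlinear part of the feature map: `φ̃(x) = (φ(vₖᵀx) − μ₁ vₖᵀx)ₖ`. -/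
def tfeatureMap {p d : ℕ} (φ : ℝ → ℝ) (V : Fin p → Fin d → ℝ) (x : Fin d → ℝ) :
    Fin p → ℝ := fun k => φ (dotp (V k) x) - hermiteCoeff φ 1 * dotp (V k) x

/-- `μ̃² := Σ_{l ≥ 3} μ_l²`. -/
def tmu2 (φ : ℝ → ℝ) : ℝ := ∑' l : ℕ, if 3 ≤ l then (hermiteCoeff φ l) ^ 2 else 0

/-- The law of the random features matrix: i.i.d. entries `N(0, 1/d)`. -/
def gaussianMatrix (p d : ℕ) : Measure (Fin p → Fin d → ℝ) :=
  Measure.pi fun _ => Measure.pi fun _ => gaussianReal 0 ((d : NNReal))⁻¹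

/-- Sub-Gaussian norm of a distribution on `ℝ^d`:
`sup_{‖u‖₂ = 1} inf { t > 0 : E exp((uᵀx)²/t²) ≤ 2 }`. -/
def vecSubGNorm {d : ℕ} (P : Measure (Fin d → ℝ)) : ℝ :=
  ⨆ u : {u : Fin d → ℝ // eNorm u = 1},
    sInf {t : ℝ | 0 < t ∧ ∫ x, Real.exp ((dotp u.1 x) ^ 2 / t ^ 2) ∂P ≤ 2}

/-- Data assumption: `P` is a probability distribution on `ℝ^d` with `‖x‖₂ = √d` a.s.
and sub-Gaussian norm at most `K`. -/
structure DataAssumption {d : ℕ} (P : Measure (Fin d → ℝ)) (K : ℝ) : Prop where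
  prob : IsProbabilityMeasure P
  norm_eq : ∀ᵐ x ∂P, eNorm x = Real.sqrt d
  subg : vecSubGNorm P ≤ K

/-- Core activation assumption: `φ` is non-linear, Lipschitz, with Lipschitz derivative,
`μ₀ = μ₂ = 0` and `μ₁ ≠ 0`. -/
structure ActivationAssumptionCore (φ : ℝ → ℝ) : Prop where
  nonlinear : ¬ ∃ a b : ℝ, ∀ z, φ z = a * z + b
  lipschitz : ∃ L : NNReal, LipschitzWith L φ
  differentiable : Differentiable ℝ φ
  deriv_lipschitz : ∃ L' : NNReal, LipschitzWith L' (deriv φ)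
  mu0 : hermiteCoeff φ 0 = 0
  mu2 : hermiteCoeff φ 2 = 0
  mu1 : hermiteCoeff φ 1 ≠ 0

/-- Full activation assumption: additionally, there are two non-zero Hermite coefficients
of order ≥ 3 with different parity. -/
structure ActivationAssumption (φ : ℝ → ℝ) extends ActivationAssumptionCore φ : Prop where
  parity : ∃ l l' : ℕ, 3 ≤ l ∧ 3 ≤ l' ∧ l % 2 ≠ l' % 2 ∧
    hermiteCoeff φ l ≠ 0 ∧ hermiteCoeff φ l' ≠ 0

lemma near_zero_or_one (r ε : ℝ) (hr : |r| ≤ 1) (hε : 0 ≤ ε) (l l' : ℕ) (hl : 3 ≤ l) (hl' : 3 ≤ l')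
    (hpar : l % 2 ≠ l' % 2) (h1 : |r - r ^ l| ≤ ε) (h2 : |r - r ^ l'| ≤ ε) :
    |r| ≤ 2 * ε ∨ 1 - 2 * ε ≤ r := by
  obtain ⟨hr1, hr2⟩ := abs_le.mp hr
  rcases le_or_gt 0 r with h0 | h0
  · have : r ^ l ≤ r ^ 2 := pow_le_pow_of_le_one h0 hr2 (by omega)
    have h3 : r - r ^ 2 ≤ ε := by linarith [(abs_le.mp h1).2]
    by_cases hh : r ≤ 1/2
    · left; rw [abs_of_nonneg h0]; nlinarith
    · right; push Not at hh; nlinarith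
  · left
    have key : ∀ m : ℕ, m % 2 = 0 → |r - r ^ m| ≤ ε → |r| ≤ 2 * ε := by
      intro m hm h
      have : 0 ≤ r ^ m := (Nat.even_iff.mpr hm).pow_nonneg r
      rw [abs_of_neg h0]
      have := (abs_le.mp h).1
      linarith
    rcases Nat.mod_two_eq_zero_or_one l with h | h
    · exact key l h h1
    · exact key l' (by omega) h2

lemma abs_pow_sub_pow_le' (a b s : ℝ) (ha : |a| ≤ s) (hb : |b| ≤ s) (hs : s ≤ 1) (l : ℕ)
    (hl : 2 ≤ l) : |a ^ l - b ^ l| ≤ l * s * |a - b| := by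
  have hs0 : 0 ≤ s := (abs_nonneg a).trans ha
  rw [← Commute.geom_sum₂_mul (Commute.all a b), abs_mul]
  gcongr
  refine (Finset.abs_sum_le_sum_abs _ _).trans ?_
  calc ∑ i ∈ Finset.range l, |a ^ i * b ^ (l - 1 - i)| ≤ ∑ i ∈ Finset.range l, s := by
        apply Finset.sum_le_sum
        intro i hi
        rw [Finset.mem_range] at hi
        rw [abs_mul, abs_pow, abs_pow]
        calc |a| ^ i * |b| ^ (l-1-i) ≤ s ^ i * s ^ (l-1-i) := by gcongr
          _ = s ^ (l - 1) := by rw [← pow_add]; congr 1; omega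
          _ ≤ s ^ 1 := pow_le_pow_of_le_one hs0 hs (by omega)
          _ = s := pow_one s
    _ = l * s := by simp

section det
variable {E W : Type*} [NormedAddCommGroup E] [InnerProductSpace ℝ E] [AddCommGroup W] [Module ℝ W]

lemma inner_unit_le {x y : E} (hx : ‖x‖ = 1) (hy : ‖y‖ = 1) : |inner ℝ x y| ≤ 1 := by
  have := abs_real_inner_le_norm x y
  rwa [hx, hy, one_mul] at this

/-- coarse stage -/
lemma coarse_stage (Φ : E → W) (T : ℕ → E → (W →ₗ[ℝ] ℝ)) (ε : ℝ) (hε : 0 ≤ ε) (hε' : ε ≤ 1/100)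
    (l l' : ℕ) (hl : 3 ≤ l) (hl' : 3 ≤ l')
    (hpar : l % 2 ≠ l' % 2)
    (A : ∀ m, m = 1 ∨ m = l ∨ m = l' → ∀ x y : E, ‖x‖ = 1 → ‖y‖ = 1 →
      |T m y (Φ x) - (inner ℝ x y) ^ m| ≤ ε)
    (x₁ x₂ : E) (h₁ : ‖x₁‖ = 1) (h₂ : ‖x₂‖ = 1) (h12 : |inner ℝ x₁ x₂| ≤ ε)
    (z : E) (hz : ‖z‖ = 1) (a₁ a₂ : ℝ) (hspan : Φ z = a₁ • Φ x₁ + a₂ • Φ x₂) :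
    1 - 40 * ε ≤ inner ℝ z x₁ ∨ 1 - 40 * ε ≤ inner ℝ z x₂ := by
  -- pow of small inner product
  have hpow : ∀ m, m = 1 ∨ m = l ∨ m = l' → |(inner ℝ x₁ x₂ : ℝ) ^ m| ≤ ε := by
    intro m hm
    rw [abs_pow]
    calc |(inner ℝ x₁ x₂ : ℝ)| ^ m ≤ |(inner ℝ x₁ x₂ : ℝ)| ^ 1 :=
          pow_le_pow_of_le_one (abs_nonneg _) (inner_unit_le h₁ h₂) (by omega)
      _ ≤ ε := by simpa using h12
  have hb : ∀ m, m = 1 ∨ m = l ∨ m = l' → ∀ y : E, ‖y‖ = 1 →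
      |(inner ℝ z y) ^ m - a₁ * (inner ℝ x₁ y)^m - a₂ * (inner ℝ x₂ y)^m|
        ≤ ε * (1 + |a₁| + |a₂|) := by
    intro m hm y hy
    have e0 := A m hm z y hz hy
    have e1 := A m hm x₁ y h₁ hy
    have e2 := A m hm x₂ y h₂ hy
    rw [hspan, map_add, map_smul, map_smul, smul_eq_mul, smul_eq_mul] at e0
    have e1' : |a₁ * (T m y (Φ x₁) - (inner ℝ x₁ y) ^ m)| ≤ |a₁| * ε := by rw [abs_mul]; gcongr
    have e2' : |a₂ * (T m y (Φ x₂) - (inner ℝ x₂ y) ^ m)| ≤ |a₂| * ε := by rw [abs_mul]; gcongr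
    rw [abs_le] at *
    constructor <;> linarith [e0.1, e0.2, e1'.1, e1'.2, e2'.1, e2'.2]
  have s11 : (inner ℝ x₁ x₁ : ℝ) = 1 := by rw [real_inner_self_eq_norm_sq, h₁]; norm_num
  have s22 : (inner ℝ x₂ x₂ : ℝ) = 1 := by rw [real_inner_self_eq_norm_sq, h₂]; norm_num
  have szz : (inner ℝ z z : ℝ) = 1 := by rw [real_inner_self_eq_norm_sq, hz]; norm_num
  have k1 : ∀ m, m = 1 ∨ m = l ∨ m = l' →
      |(inner ℝ z x₁)^m - a₁| ≤ ε * (1 + |a₁| + 2 * |a₂|) := by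
    intro m hm
    have := hb m hm x₁ h₁
    rw [s11, one_pow, real_inner_comm] at this
    have e : |a₂ * (inner ℝ x₁ x₂)^m| ≤ |a₂| * ε := by rw [abs_mul]; gcongr; exact hpow m hm
    rw [real_inner_comm x₁ x₂] at this
    rw [real_inner_comm] at this
    rw [abs_le] at *
    constructor <;> linarith [e.1, e.2, this.1, this.2]
  have k2 : ∀ m, m = 1 ∨ m = l ∨ m = l' →
      |(inner ℝ z x₂)^m - a₂| ≤ ε * (1 + 2 * |a₁| + |a₂|) := by
    intro m hm
    have := hb m hm x₂ h₂
    rw [s22, one_pow] at this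
    have e : |a₁ * (inner ℝ x₁ x₂)^m| ≤ |a₁| * ε := by rw [abs_mul]; gcongr; exact hpow m hm
    rw [abs_le] at *
    constructor <;> linarith [e.1, e.2, this.1, this.2]
  set r₁ : ℝ := inner ℝ z x₁ with hr₁
  set r₂ : ℝ := inner ℝ z x₂ with hr₂
  have b1 : |r₁| ≤ 1 := inner_unit_le hz h₁
  have b2 : |r₂| ≤ 1 := inner_unit_le hz h₂
  have ab : |a₁| + |a₂| ≤ 3 := by
    have c1 := k1 1 (Or.inl rfl)
    have c2 := k2 1 (Or.inl rfl)
    rw [pow_one] at c1 c2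
    have d1 : |a₁| ≤ |r₁| + |r₁ - a₁| := by
      have := abs_sub_abs_le_abs_sub a₁ r₁; rw [abs_sub_comm] at this; linarith
    have d2 : |a₂| ≤ |r₂| + |r₂ - a₂| := by
      have := abs_sub_abs_le_abs_sub a₂ r₂; rw [abs_sub_comm] at this; linarith
    nlinarith [abs_nonneg a₁, abs_nonneg a₂]
  have n1 := abs_nonneg a₁
  have n2 := abs_nonneg a₂
  have k1' : ∀ m, m = 1 ∨ m = l ∨ m = l' → |r₁ ^ m - a₁| ≤ 7 * ε := by
    intro m hm; have := k1 m hm; nlinarith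
  have k2' : ∀ m, m = 1 ∨ m = l ∨ m = l' → |r₂ ^ m - a₂| ≤ 7 * ε := by
    intro m hm; have := k2 m hm; nlinarith
  have d : ∀ r a : ℝ, (∀ m, m = 1 ∨ m = l ∨ m = l' → |r ^ m - a| ≤ 7 * ε) → |r| ≤ 1 →
      |r| ≤ 28 * ε ∨ 1 - 28 * ε ≤ r := by
    intro r a h hr
    have e1 := h 1 (by simp)
    have e2 := h l (by simp)
    have e3 := h l' (by simp)
    rw [pow_one] at e1
    have := near_zero_or_one r (14 * ε) hr (by linarith) l l' hl hl' hpar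
      (by rw [abs_le] at *; constructor <;> linarith [e1.1, e1.2, e2.1, e2.2])
      (by rw [abs_le] at *; constructor <;> linarith [e1.1, e1.2, e3.1, e3.2])
    rcases this with h | h
    · left; linarith
    · right; linarith
  have kz := hb 1 (by simp) z hz
  rw [pow_one, pow_one, pow_one, szz, real_inner_comm, real_inner_comm z x₂, ← hr₁, ← hr₂] at kz
  rcases d r₁ a₁ k1' b1 with g1 | g1
  · rcases d r₂ a₂ k2' b2 with g2 | g2
    · exfalso
      have f1 : |a₁ * r₁| ≤ 3 * (28 * ε) := by
        rw [abs_mul]; exact mul_le_mul (by linarith) g1 (abs_nonneg _) (by norm_num)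
      have f2 : |a₂ * r₂| ≤ 3 * (28 * ε) := by
        rw [abs_mul]; exact mul_le_mul (by linarith) g2 (abs_nonneg _) (by norm_num)
      -- improve: a's are small
      have c1 := k1' 1 (by simp)
      have c2 := k2' 1 (by simp)
      rw [pow_one] at c1 c2
      have aa1 : |a₁| ≤ 35 * ε := by
        rw [abs_le] at *; constructor <;> linarith [c1.1, c1.2, g1.1, g1.2]
      have aa2 : |a₂| ≤ 35 * ε := by
        rw [abs_le] at *; constructor <;> linarith [c2.1, c2.2, g2.1, g2.2]
      have f1 : |a₁ * r₁| ≤ (35 * ε) * (28 * ε) := by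
        rw [abs_mul]; exact mul_le_mul aa1 g1 (abs_nonneg _) (by linarith)
      have f2 : |a₂ * r₂| ≤ (35 * ε) * (28 * ε) := by
        rw [abs_mul]; exact mul_le_mul aa2 g2 (abs_nonneg _) (by linarith)
      have q1 := (abs_le.mp kz).2
      have q2 := (abs_le.mp f1).2
      have q3 := (abs_le.mp f2).2
      nlinarith
    · right; linarith
  · left; linarith

/-- fine stage: two reconstructions cannot both be close to the same sample. -/
lemma fine_stage (Φ : E → W) (T : ℕ → E → (W →ₗ[ℝ] ℝ)) (ε η : ℝ) (hε : 0 ≤ ε) (hη : 0 ≤ η)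
    (l : ℕ) (hl : 3 ≤ l) (hε' : ε ≤ 1/100) (hη' : η ≤ 1/100)
    (hεl : l * ε ≤ 1 / 100) (hηl : l * η ≤ 1 / 100)
    (A : ∀ m, m = 1 ∨ m = l → ∀ x y : E, ‖x‖ = 1 → ‖y‖ = 1 →
      |T m y (Φ x) - (inner ℝ x y) ^ m| ≤ ε)
    (B : ∀ m, m = 1 ∨ m = l → ∀ x x' y : E, ‖x‖ = 1 → ‖x'‖ = 1 → ‖y‖ = 1 →
      |T m y (Φ x' - Φ x) - ((inner ℝ x' y) ^ m - (inner ℝ x y) ^ m)| ≤ ε * ‖x' - x‖)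
    (x₁ x₂ : E) (h₁ : ‖x₁‖ = 1) (h₂ : ‖x₂‖ = 1) (h12 : |inner ℝ x₁ x₂| ≤ ε)
    (z₁ z₂ : E) (hz₁ : ‖z₁‖ = 1) (hz₂ : ‖z₂‖ = 1) (hc₁ : ‖z₁ - x₁‖ ≤ η) (hc₂ : ‖z₂ - x₁‖ ≤ η)
    (b₁ b₂ : ℝ) (hspan : Φ x₂ = b₁ • Φ z₁ + b₂ • Φ z₂) : False := by
  set τ := ‖z₂ - z₁‖ with hτ
  have hτ0 : 0 ≤ τ := norm_nonneg _
  set c := b₁ + b₂ with hcdef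
  set w := b₂ * τ with hw
  have hspan' : Φ x₂ = c • Φ z₁ + b₂ • (Φ z₂ - Φ z₁) := by
    rw [hspan, hcdef]; module
  have nc := abs_nonneg c
  have nw := abs_nonneg w
  have hwabs : |w| = |b₂| * τ := by rw [hw, abs_mul, abs_of_nonneg hτ0]
  have key : ∀ m, m = 1 ∨ m = l → ∀ y : E, ‖y‖ = 1 →
      |(inner ℝ x₂ y)^m - c * (inner ℝ z₁ y)^m - b₂ * ((inner ℝ z₂ y)^m - (inner ℝ z₁ y)^m)|
        ≤ ε * (1 + |c| + |w|) := by
    intro m hm y hy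
    have e0 := A m hm x₂ y h₂ hy
    have e1 := A m hm z₁ y hz₁ hy
    have e2 := B m hm z₁ z₂ y hz₁ hz₂ hy
    rw [hspan', map_add, map_smul, map_smul, smul_eq_mul, smul_eq_mul] at e0
    have e1' : |c * (T m y (Φ z₁) - (inner ℝ z₁ y) ^ m)| ≤ |c| * ε := by rw [abs_mul]; gcongr
    have e2' : |b₂ * (T m y (Φ z₂ - Φ z₁) - ((inner ℝ z₂ y) ^ m - (inner ℝ z₁ y)^m))|
        ≤ |w| * ε := by
      rw [abs_mul, hwabs]
      calc _ ≤ |b₂| * (ε * τ) := by gcongr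
        _ = _ := by ring
    rw [abs_le] at *
    constructor <;> linarith [e0.1, e0.2, e1'.1, e1'.2, e2'.1, e2'.2]
  have s22 : (inner ℝ x₂ x₂ : ℝ) = 1 := by rw [real_inner_self_eq_norm_sq, h₂]; norm_num
  -- step 1
  have rb : ∀ z : E, ‖z - x₁‖ ≤ η → |(inner ℝ z x₂ : ℝ)| ≤ ε + η := by
    intro z hz
    have : (inner ℝ z x₂ : ℝ) = inner ℝ x₁ x₂ + inner ℝ (z - x₁) x₂ := by
      rw [← inner_add_left]; congr 1; abel
    rw [this]
    refine (abs_add_le _ _).trans (add_le_add h12 ?_)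
    refine (abs_real_inner_le_norm _ _).trans ?_
    rw [h₂, mul_one]; exact hz
  have r1 := rb z₁ hc₁
  have r2 := rb z₂ hc₂
  have step1 : 1 ≤ |c| * (ε + η) + |w| * (l * (ε + η)) + ε * (1 + |c| + |w|) := by
    have k := key l (by simp) x₂ h₂
    rw [s22, one_pow] at k
    have t1 : |c * (inner ℝ z₁ x₂)^l| ≤ |c| * (ε + η) := by
      rw [abs_mul, abs_pow]; gcongr
      calc |(inner ℝ z₁ x₂ : ℝ)| ^ l ≤ |(inner ℝ z₁ x₂ : ℝ)| ^ 1 :=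
          pow_le_pow_of_le_one (abs_nonneg _) (inner_unit_le hz₁ h₂) (by omega)
        _ ≤ _ := by simpa using r1
    have t2 : |b₂ * ((inner ℝ z₂ x₂)^l - (inner ℝ z₁ x₂)^l)| ≤ |w| * (l * (ε + η)) := by
      rw [abs_mul, hwabs]
      have := abs_pow_sub_pow_le' (inner ℝ z₂ x₂) (inner ℝ z₁ x₂) (ε + η) r2 r1 (by linarith) l
        (by omega)
      have t3 : |(inner ℝ z₂ x₂ : ℝ) - inner ℝ z₁ x₂| ≤ τ := by
        rw [← inner_sub_left]
        refine (abs_real_inner_le_norm _ _).trans ?_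
        rw [h₂, mul_one]
      calc _ ≤ |b₂| * (l * (ε + η) * τ) := by
            gcongr; exact this.trans (by gcongr)
        _ = _ := by ring
    have := (abs_le.mp k).2
    linarith [(abs_le.mp t1).2, (abs_le.mp t2).2]
  -- step 2
  have zx : (1:ℝ)/2 ≤ inner ℝ z₁ x₁ := by
    have := norm_sub_sq_real z₁ x₁
    rw [hz₁, h₁] at this
    have : ‖z₁ - x₁‖ ^ 2 ≤ 1 := by
      have := norm_nonneg (z₁ - x₁); nlinarith
    linarith
  have dz : |(inner ℝ z₂ x₁ : ℝ) - inner ℝ z₁ x₁| ≤ τ * η := by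
    have e : (inner ℝ z₂ x₁ : ℝ) - inner ℝ z₁ x₁
        = - ((1/2 : ℝ) * (inner ℝ (z₂ - z₁) (z₁ - x₁) + inner ℝ (z₂ - z₁) (z₂ - x₁))) := by
      simp only [inner_sub_left, inner_sub_right, real_inner_self_eq_norm_sq, hz₁, hz₂]
      rw [real_inner_comm z₁ z₂]; ring
    have f1 := (abs_real_inner_le_norm (z₂ - z₁) (z₁ - x₁)).trans
      (mul_le_mul_of_nonneg_left hc₁ hτ0)
    have f2 := (abs_real_inner_le_norm (z₂ - z₁) (z₂ - x₁)).trans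
      (mul_le_mul_of_nonneg_left hc₂ hτ0)
    rw [e]
    rw [abs_le] at *
    constructor <;> linarith [f1.1, f1.2, f2.1, f2.2]
  have step2 : |c| / 2 ≤ ε + |w| * η + ε * (1 + |c| + |w|) := by
    have k := key 1 (by simp) x₁ h₁
    rw [pow_one, pow_one, pow_one] at k
    have t2 : |b₂ * ((inner ℝ z₂ x₁) - (inner ℝ z₁ x₁))| ≤ |w| * η := by
      rw [abs_mul, hwabs, mul_assoc]; gcongr
    have t1 : |c| / 2 ≤ |c * (inner ℝ z₁ x₁)| := by
      rw [abs_mul, abs_of_nonneg (by linarith : (0:ℝ) ≤ inner ℝ z₁ x₁)]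
      nlinarith
    rw [real_inner_comm] at h12
    have t4 : |c * (inner ℝ z₁ x₁)| ≤ ε + |w| * η + ε * (1 + |c| + |w|) := by
      rw [abs_le] at *
      constructor <;> linarith [k.1, k.2, t2.1, t2.2, h12.1, h12.2]
    linarith
  -- step 3
  have step3 : |w| ≤ 1 + |c| + ε * (1 + |c| + |w|) := by
    rcases hτ0.eq_or_lt with h0 | h0
    · have : w = 0 := by rw [hw, ← h0, mul_zero]
      rw [this]; simp; positivity
    · set u : E := τ⁻¹ • (z₂ - z₁) with hu
      have hun : ‖u‖ = 1 := by
        rw [hu, norm_smul, norm_inv, Real.norm_of_nonneg hτ0, ← hτ]; field_simp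
      have k := key 1 (by simp) u hun
      rw [pow_one, pow_one, pow_one, ← inner_sub_left] at k
      have e : b₂ * inner ℝ (z₂ - z₁) u = w := by
        rw [hu, inner_smul_right, real_inner_self_eq_norm_sq, ← hτ, hw]; field_simp
      rw [e] at k
      have t1 : |(inner ℝ x₂ u : ℝ)| ≤ 1 := inner_unit_le h₂ hun
      have t2 : |c * (inner ℝ z₁ u : ℝ)| ≤ |c| := by
        rw [abs_mul]; exact mul_le_of_le_one_right nc (inner_unit_le hz₁ hun)
      rw [abs_le] at k t1 t2
      rw [abs_le]
      constructor <;> linarith [k.1, k.2, t1.1, t1.2, t2.1, t2.2]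
  have hX : ε * (1 + |c| + |w|) ≤ 1/100 * (1 + |c| + |w|) := by gcongr
  have hY : |w| * η ≤ |w| * (1/100) := by gcongr
  have c2 : |c| ≤ 1/10 + |w| / 20 := by linarith
  have w2 : |w| ≤ 13/10 := by linarith
  have hZ : |w| * (l * (ε + η)) ≤ |w| * (1/50) := by gcongr; linarith
  have hZ' : |c| * (ε + η) ≤ |c| * (1/50) := by gcongr; linarith
  linarith

/-- deterministic reconstruction -/
lemma det_reconstruct (Φ : E → W) (T : ℕ → E → (W →ₗ[ℝ] ℝ)) (ε η : ℝ) (hε : 0 ≤ ε) (hη : 0 ≤ η)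
    (l l' : ℕ) (hl : 3 ≤ l) (hl' : 3 ≤ l') (hpar : l % 2 ≠ l' % 2)
    (hε' : ε ≤ 1/100) (hη' : η ≤ 1/100)
    (hεl : l * ε ≤ 1 / 100) (hηl : l * η ≤ 1 / 100) (hεη : 80 * ε ≤ η ^ 2)
    (A : ∀ m, m = 1 ∨ m = l ∨ m = l' → ∀ x y : E, ‖x‖ = 1 → ‖y‖ = 1 →
      |T m y (Φ x) - (inner ℝ x y) ^ m| ≤ ε)
    (B : ∀ m, m = 1 ∨ m = l ∨ m = l' → ∀ x x' y : E, ‖x‖ = 1 → ‖x'‖ = 1 → ‖y‖ = 1 →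
      |T m y (Φ x' - Φ x) - ((inner ℝ x' y) ^ m - (inner ℝ x y) ^ m)| ≤ ε * ‖x' - x‖)
    (x : Fin 2 → E) (hx : ∀ i, ‖x i‖ = 1) (h12 : |inner ℝ (x 0) (x 1)| ≤ ε)
    (z : Fin 2 → E) (hz : ∀ i, ‖z i‖ = 1)
    (hspan : ∀ i, Φ (x i) ∈ Submodule.span ℝ (Set.range fun j => Φ (z j))) :
    ∀ i, ∃ j, ‖z j - x i‖ ≤ η := by
  have hsp : ∀ i, ∃ b₁ b₂ : ℝ, Φ (x i) = b₁ • Φ (z 0) + b₂ • Φ (z 1) := by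
    intro i
    have := hspan i
    rw [Submodule.mem_span_range_iff_exists_fun] at this
    obtain ⟨c, hc⟩ := this
    exact ⟨c 0, c 1, by rw [← hc, Fin.sum_univ_two]⟩
  obtain ⟨a, b, h0⟩ := hsp 0
  obtain ⟨c, d, h1⟩ := hsp 1
  have A' : ∀ m, m = 1 ∨ m = l → ∀ x y : E, ‖x‖ = 1 → ‖y‖ = 1 →
      |T m y (Φ x) - (inner ℝ x y) ^ m| ≤ ε := fun m hm => A m (by tauto)
  have B' : ∀ m, m = 1 ∨ m = l → ∀ x x' y : E, ‖x‖ = 1 → ‖x'‖ = 1 → ‖y‖ = 1 →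
      |T m y (Φ x' - Φ x) - ((inner ℝ x' y) ^ m - (inner ℝ x y) ^ m)| ≤ ε * ‖x' - x‖ :=
    fun m hm => B m (by tauto)
  -- linear independence
  have lin : ∀ α β : ℝ, α • Φ (x 0) + β • Φ (x 1) = 0 → α = 0 ∧ β = 0 := by
    intro α β h
    have s00 : (inner ℝ (x 0) (x 0) : ℝ) = 1 := by
      rw [real_inner_self_eq_norm_sq, hx]; norm_num
    have s11 : (inner ℝ (x 1) (x 1) : ℝ) = 1 := by
      rw [real_inner_self_eq_norm_sq, hx]; norm_num
    have key : ∀ y : E, ‖y‖ = 1 →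
        |α * inner ℝ (x 0) y + β * inner ℝ (x 1) y| ≤ ε * (|α| + |β|) := by
      intro y hy
      have e1 := A 1 (by simp) (x 0) y (hx 0) hy
      have e2 := A 1 (by simp) (x 1) y (hx 1) hy
      have e0 : T 1 y (α • Φ (x 0) + β • Φ (x 1)) = 0 := by rw [h, map_zero]
      rw [map_add, map_smul, map_smul, smul_eq_mul, smul_eq_mul] at e0
      have e1' : |α * (T 1 y (Φ (x 0)) - (inner ℝ (x 0) y) ^ 1)| ≤ |α| * ε := by
        rw [abs_mul]; gcongr
      have e2' : |β * (T 1 y (Φ (x 1)) - (inner ℝ (x 1) y) ^ 1)| ≤ |β| * ε := by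
        rw [abs_mul]; gcongr
      rw [pow_one] at e1' e2'
      rw [abs_le] at *
      constructor <;> linarith [e1'.1, e1'.2, e2'.1, e2'.2]
    have k0 := key (x 0) (hx 0)
    have k1 := key (x 1) (hx 1)
    rw [s00, real_inner_comm (x 0) (x 1)] at k0
    rw [s11] at k1
    have t0 : |β * inner ℝ (x 0) (x 1)| ≤ |β| * ε := by rw [abs_mul]; gcongr
    have t1 : |α * inner ℝ (x 0) (x 1)| ≤ |α| * ε := by rw [abs_mul]; gcongr
    have na := abs_nonneg α
    have nb := abs_nonneg β
    have u0 : |α| ≤ ε * (|α| + |β|) + |β| * ε := by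
      have : |α * 1| ≤ ε * (|α| + |β|) + |β| * ε := by
        rw [abs_le] at *; constructor <;> linarith [k0.1, k0.2, t0.1, t0.2]
      simpa using this
    have u1 : |β| ≤ ε * (|α| + |β|) + |α| * ε := by
      have : |β * 1| ≤ ε * (|α| + |β|) + |α| * ε := by
        rw [abs_le] at *; constructor <;> linarith [k1.1, k1.2, t1.1, t1.2]
      simpa using this
    have : |α| + |β| ≤ 0 := by nlinarith
    exact ⟨abs_eq_zero.mp (by linarith), abs_eq_zero.mp (by linarith)⟩
  have hdet : a * d - b * c ≠ 0 := by
    intro hd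
    have e1 := lin d (-b) (by
      rw [h0, h1]
      have : d • (a • Φ (z 0) + b • Φ (z 1)) + (-b) • (c • Φ (z 0) + d • Φ (z 1))
        = (a * d - b * c) • Φ (z 0) := by module
      rw [this, hd, zero_smul])
    have e2 := lin (-c) a (by
      rw [h0, h1]
      have : (-c) • (a • Φ (z 0) + b • Φ (z 1)) + a • (c • Φ (z 0) + d • Φ (z 1))
        = (a * d - b * c) • Φ (z 1) := by module
      rw [this, hd, zero_smul])
    have hd0 := e1.1
    have hb0 : b = 0 := by linarith [e1.2]
    have ha0 := e2.2
    have := lin 1 0 (by rw [h0, ha0, hb0]; simp)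
    exact one_ne_zero this.1
  set Δ := a * d - b * c with hΔ
  have i0 : Φ (z 0) = (d / Δ) • Φ (x 0) + (-b / Δ) • Φ (x 1) := by
    rw [h0, h1]
    have : (d / Δ) • (a • Φ (z 0) + b • Φ (z 1)) + (-b / Δ) • (c • Φ (z 0) + d • Φ (z 1))
      = (Δ / Δ) • Φ (z 0) := by rw [hΔ]; module
    rw [this, div_self hdet, one_smul]
  have i1 : Φ (z 1) = (-c / Δ) • Φ (x 0) + (a / Δ) • Φ (x 1) := by
    rw [h0, h1]
    have : (-c / Δ) • (a • Φ (z 0) + b • Φ (z 1)) + (a / Δ) • (c • Φ (z 0) + d • Φ (z 1))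
      = (Δ / Δ) • Φ (z 1) := by rw [hΔ]; module
    rw [this, div_self hdet, one_smul]
  have close : ∀ i j, 1 - 40 * ε ≤ inner ℝ (z j) (x i) → ‖z j - x i‖ ≤ η := by
    intro i j h
    have e := norm_sub_sq_real (z j) (x i)
    rw [hz, hx] at e
    have : ‖z j - x i‖ ^ 2 ≤ η ^ 2 := by linarith
    exact abs_le_of_sq_le_sq' this hη |>.2
  have c0 := coarse_stage Φ T ε hε hε' l l' hl hl' hpar A (x 0) (x 1) (hx 0) (hx 1) h12 (z 0) (hz 0)
    _ _ i0
  have c1 := coarse_stage Φ T ε hε hε' l l' hl hl' hpar A (x 0) (x 1) (hx 0) (hx 1) h12 (z 1) (hz 1)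
    _ _ i1
  have h21 : |inner ℝ (x 1) (x 0)| ≤ ε := by rwa [real_inner_comm]
  rcases c0 with c0 | c0 <;> rcases c1 with c1 | c1
  · exact (fine_stage Φ T ε η hε hη l hl hε' hη' hεl hηl A' B' (x 0) (x 1) (hx 0) (hx 1) h12
      (z 0) (z 1) (hz 0) (hz 1) (close _ _ c0) (close _ _ c1) _ _ h1).elim
  · intro i; fin_cases i
    · exact ⟨0, close _ _ c0⟩
    · exact ⟨1, close _ _ c1⟩
  · intro i; fin_cases i
    · exact ⟨1, close _ _ c1⟩
    · exact ⟨0, close _ _ c0⟩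
  · exact (fine_stage Φ T ε η hε hη l hl hε' hη' hεl hηl A' B' (x 1) (x 0) (hx 1) (hx 0) h21
      (z 0) (z 1) (hz 0) (hz 1) (close _ _ c0) (close _ _ c1) _ _ h0).elim

end det

/-- law of one row of the features matrix -/
def rowG (d : ℕ) : Measure (Fin d → ℝ) := Measure.pi fun _ => gaussianReal 0 ((d : NNReal))⁻¹

instance (d : ℕ) : IsProbabilityMeasure (rowG d) := by unfold rowG; infer_instance

lemma dotp_comm {m : ℕ} (u v : Fin m → ℝ) : dotp u v = dotp v u := by
  simp [dotp, mul_comm]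

lemma dotp_add_right {m : ℕ} (v x y : Fin m → ℝ) : dotp v (x + y) = dotp v x + dotp v y := by
  simp [dotp, mul_add, Finset.sum_add_distrib]

lemma dotp_sub_right {m : ℕ} (v x y : Fin m → ℝ) : dotp v (x - y) = dotp v x - dotp v y := by
  simp [dotp, mul_sub, Finset.sum_sub_distrib]

lemma dotp_smul_right {m : ℕ} (v x : Fin m → ℝ) (c : ℝ) : dotp v (c • x) = c * dotp v x := by
  simp only [dotp, Pi.smul_apply, smul_eq_mul, Finset.mul_sum]
  exact Finset.sum_congr rfl fun i _ => by ring

@[fun_prop]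
lemma continuous_dotp_left {m : ℕ} (x : Fin m → ℝ) : Continuous fun v => dotp v x := by
  unfold dotp; fun_prop

@[fun_prop]
lemma measurable_dotp_left {m : ℕ} (x : Fin m → ℝ) : Measurable fun v => dotp v x :=
  (continuous_dotp_left x).measurable

/-- dot product as a continuous linear map -/
def dotL {m : ℕ} (x : Fin m → ℝ) : (Fin m → ℝ) →L[ℝ] ℝ :=
  ∑ j, x j • ContinuousLinearMap.proj (R := ℝ) (φ := fun _ : Fin m => ℝ) j

lemma dotL_apply {m : ℕ} (x v : Fin m → ℝ) : dotL x v = dotp v x := by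
  simp [dotL, dotp, mul_comm]

lemma rowG_indep (d : ℕ) : iIndepFun (fun (i : Fin d) (v : Fin d → ℝ) => v i) (rowG d) :=
  iIndepFun_pi (X := fun _ => id) (fun _ => aemeasurable_id)

lemma rowG_map_eval (d : ℕ) (i : Fin d) :
    (rowG d).map (fun v => v i) = gaussianReal 0 ((d : NNReal))⁻¹ :=
  (measurePreserving_eval (fun _ : Fin d => gaussianReal 0 ((d : NNReal))⁻¹) i).map_eq

lemma rowG_eval_gaussian (d : ℕ) (i : Fin d) : HasGaussianLaw (fun v : Fin d → ℝ => v i) (rowG d) :=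
  ⟨by rw [rowG_map_eval]; infer_instance⟩

lemma rowG_id_gaussian (d : ℕ) : HasGaussianLaw (fun v : Fin d → ℝ => (fun i => v i)) (rowG d) :=
  iIndepFun.hasGaussianLaw (rowG_eval_gaussian d) (rowG_indep d)

lemma rowG_pair_gaussian (d : ℕ) (x y : Fin d → ℝ) :
    HasGaussianLaw (fun v : Fin d → ℝ => (dotp v x, dotp v y)) (rowG d) := by
  have := (rowG_id_gaussian d).map_fun ((dotL x).prod (dotL y))
  simpa [dotL_apply] using this

lemma rowG_dotp_gaussian (d : ℕ) (x : Fin d → ℝ) :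
    HasGaussianLaw (fun v : Fin d → ℝ => dotp v x) (rowG d) := (rowG_pair_gaussian d x x).fst

lemma rowG_integral_eval (d : ℕ) (i : Fin d) : ∫ v, v i ∂(rowG d) = 0 := by
  have h := integral_map (μ := rowG d) (φ := fun v => v i) (f := fun x : ℝ => x)
    (measurable_pi_apply i).aemeasurable (by fun_prop)
  rw [← h, rowG_map_eval, integral_id_gaussianReal]

lemma rowG_var_eval (d : ℕ) (i : Fin d) : Var[fun v => v i; rowG d] = (d : ℝ)⁻¹ := by
  have h := variance_map (μ := rowG d) (Y := fun v => v i) (X := fun x : ℝ => x)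
    (by fun_prop) (measurable_pi_apply i).aemeasurable
  rw [rowG_map_eval, variance_fun_id_gaussianReal] at h
  have h2 : (fun x : ℝ => x) ∘ (fun v : Fin d → ℝ => v i) = fun v => v i := rfl
  rw [h2] at h
  rw [← h]; simp

lemma rowG_integral_dotp (d : ℕ) (x : Fin d → ℝ) : ∫ v, dotp v x ∂(rowG d) = 0 := by
  unfold dotp
  rw [integral_finsetSum]
  · simp [integral_mul_const, rowG_integral_eval]
  · intro i _
    exact (rowG_eval_gaussian d i).integrable.mul_const _

lemma rowG_cov (d : ℕ) (x y : Fin d → ℝ) :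
    cov[fun v => dotp v x, fun v => dotp v y; rowG d] = dotp x y / d := by
  unfold dotp
  rw [covariance_fun_sum_fun_sum]
  · simp only [covariance_mul_const_left, covariance_mul_const_right]
    have : ∀ i j : Fin d, cov[fun v : Fin d → ℝ => v i, fun v => v j; rowG d]
        = if i = j then (d : ℝ)⁻¹ else 0 := by
      intro i j
      split_ifs with h
      · subst h
        rw [covariance_self (measurable_pi_apply i).aemeasurable, rowG_var_eval]
      · exact ((rowG_indep d).indepFun h).covariance_eq_zero (rowG_eval_gaussian d i).memLp_two
          (rowG_eval_gaussian d j).memLp_two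
    simp only [this]
    simp [div_eq_mul_inv]
    rw [Finset.sum_mul]
    exact Finset.sum_congr rfl fun i _ => by ring
  · exact fun i => (rowG_eval_gaussian d i).memLp_two.mul_const _
  · exact fun i => (rowG_eval_gaussian d i).memLp_two.mul_const _

lemma dotp_self_nonneg {m : ℕ} (x : Fin m → ℝ) : 0 ≤ dotp x x :=
  Finset.sum_nonneg fun i _ => mul_self_nonneg _

lemma rowG_map_dotp (d : ℕ) (x : Fin d → ℝ) :
    (rowG d).map (fun v => dotp v x) = gaussianReal 0 (dotp x x / d).toNNReal := by
  rw [(rowG_dotp_gaussian d x).map_eq_gaussianReal, rowG_integral_dotp,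
    ← covariance_self (by fun_prop), rowG_cov]

/-! polynomials under Gaussian measures -/

lemma poly_integrable (q : Polynomial ℝ) (m : ℝ) (v : NNReal) :
    Integrable (fun x => q.eval x) (gaussianReal m v) := by
  induction q using Polynomial.induction_on' with
  | add p q hp hq => simpa only [Polynomial.eval_add] using! hp.add hq
  | monomial n a =>
    simp only [Polynomial.eval_monomial]
    apply Integrable.const_mul
    have := (memLp_id_gaussianReal' (μ := m) (v := v) (n : ENNReal) (by simp)).integrable_norm_pow'
    refine (integrable_norm_iff (by fun_prop)).mp ?_
    simpa using this

lemma poly_memLp_two (q : Polynomial ℝ) (m : ℝ) (v : NNReal) :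
    MemLp (fun x => q.eval x) 2 (gaussianReal m v) := by
  rw [memLp_two_iff_integrable_sq (by fun_prop)]
  refine (poly_integrable (q ^ 2) m v).congr ?_
  filter_upwards with x
  simp

lemma gauss_stein (q : Polynomial ℝ) (s : NNReal) :
    ∫ x, x * q.eval x ∂(gaussianReal 0 s) = s * ∫ x, q.derivative.eval x ∂(gaussianReal 0 s) := by
  by_cases hs : s = 0
  · subst hs; simp
  have hs' : (s : ℝ) ≠ 0 := by exact_mod_cast hs
  have hInt : ∀ r : Polynomial ℝ, Integrable (fun x => r.eval x * gaussianPDFReal 0 s x) := by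
    intro r
    have := poly_integrable r 0 s
    rw [gaussianReal_of_var_ne_zero _ hs] at this
    rw [integrable_withDensity_iff_integrable_smul' (by fun_prop)
      (by filter_upwards with x using gaussianPDF_lt_top)] at this
    simp only [toReal_gaussianPDF, smul_eq_mul] at this
    simpa [mul_comm] using this
  have hd : ∀ x, HasDerivAt (gaussianPDFReal 0 s) (-(x / s) * gaussianPDFReal 0 s x) x := by
    intro x
    unfold gaussianPDFReal
    have h1 : HasDerivAt (fun x : ℝ => -(x - 0) ^ 2 / (2 * (s:ℝ))) (-(x / s)) x := by
      have := ((((hasDerivAt_id x).sub_const 0).pow 2).neg).div_const (2 * (s:ℝ))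
      refine HasDerivAt.congr_deriv this ?_
      simp
      field_simp
    have := (h1.exp).const_mul (√(2 * Real.pi * s))⁻¹
    refine HasDerivAt.congr_deriv this ?_
    ring
  have key := integral_mul_deriv_eq_deriv_mul_of_integrable
    (u := fun x => q.eval x) (u' := fun x => q.derivative.eval x) (v := gaussianPDFReal 0 s)
    (v' := fun x => -(x / s) * gaussianPDFReal 0 s x)
    (fun x _ => q.hasDerivAt x) (fun x _ => hd x)
    (by
      have := (hInt (Polynomial.X * q)).const_mul (-(s:ℝ)⁻¹)
      refine this.congr ?_
      filter_upwards with x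
      simp; ring) (hInt _) (hInt _)
  rw [integral_gaussianReal_eq_integral_smul hs, integral_gaussianReal_eq_integral_smul hs]
  simp only [smul_eq_mul]
  have e1 : ∫ x, gaussianPDFReal 0 s x * (x * q.eval x)
      = -s * ∫ x, q.eval x * (-(x / s) * gaussianPDFReal 0 s x) := by
    rw [← integral_const_mul]
    congr 1; ext x; field_simp
  rw [e1, key]
  simp [mul_comm]

/-- real Hermite polynomials -/
def HR (l : ℕ) : Polynomial ℝ := (Polynomial.hermite l).map (Int.castRingHom ℝ)

lemma HR_eval (l : ℕ) (x : ℝ) : (HR l).eval x = Polynomial.aeval x (Polynomial.hermite l) := by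
  rw [HR, Polynomial.eval_map, Polynomial.aeval_def]; rfl

lemma HR_succ (l : ℕ) : HR (l + 1) = Polynomial.X * HR l - Polynomial.derivative (HR l) := by
  simp [HR, Polynomial.hermite_succ, Polynomial.derivative_map]

lemma HR_zero : HR 0 = 1 := by simp [HR]

lemma HR_deriv (l : ℕ) : Polynomial.derivative (HR (l + 1)) = ((l : ℝ) + 1) • HR l := by
  induction l with
  | zero => rw [HR_succ, HR_zero]; simp
  | succ n ih =>
    rw [HR_succ (n + 1), Polynomial.derivative_sub, Polynomial.derivative_mul,
      Polynomial.derivative_X, ih, Polynomial.derivative_smul, one_mul, mul_smul_comm,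
      add_sub_assoc, ← smul_sub, ← HR_succ]
    push_cast
    module

lemma HR_smooth (ρ : ℝ) (s : NNReal) (hs : (s : ℝ) = 1 - ρ ^ 2) (a : ℝ) (l : ℕ) :
    ∫ b, (HR l).eval (ρ * a + b) ∂(gaussianReal 0 s) = ρ ^ l * (HR l).eval a ∧
    ∫ b, (HR (l+1)).eval (ρ * a + b) ∂(gaussianReal 0 s) = ρ ^ (l+1) * (HR (l+1)).eval a := by
  have shift : ∀ q : Polynomial ℝ, ∀ b, q.eval (ρ * a + b)
      = (q.comp (Polynomial.C (ρ * a) + Polynomial.X)).eval b := by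
    intro q b; simp
  have hInt : ∀ q : Polynomial ℝ, Integrable (fun b => q.eval (ρ * a + b)) (gaussianReal 0 s) := by
    intro q; simp only [shift]; exact poly_integrable _ _ _
  have st : ∀ q : Polynomial ℝ, ∫ b, b * q.eval (ρ * a + b) ∂(gaussianReal 0 s)
      = s * ∫ b, q.derivative.eval (ρ * a + b) ∂(gaussianReal 0 s) := by
    intro q
    have := gauss_stein (q.comp (Polynomial.C (ρ * a) + Polynomial.X)) s
    rw [Polynomial.derivative_comp] at this
    simpa using this
  have hInt2 : ∀ q : Polynomial ℝ,
      Integrable (fun b => b * q.eval (ρ * a + b)) (gaussianReal 0 s) := by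
    intro q
    have := poly_integrable (Polynomial.X * q.comp (Polynomial.C (ρ * a) + Polynomial.X)) 0 s
    simpa using this
  have step : ∀ l, ∫ b, (HR (l+1)).eval (ρ * a + b) ∂(gaussianReal 0 s)
      = ρ * a * ∫ b, (HR l).eval (ρ * a + b) ∂(gaussianReal 0 s)
        - ρ ^ 2 * ∫ b, (HR l).derivative.eval (ρ * a + b) ∂(gaussianReal 0 s) := by
    intro l
    have e : ∀ b, (HR (l+1)).eval (ρ * a + b) = ρ * a * (HR l).eval (ρ * a + b)
        + b * (HR l).eval (ρ * a + b) - (HR l).derivative.eval (ρ * a + b) := by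
      intro b; rw [HR_succ]; simp; ring
    simp only [e]
    rw [integral_sub, integral_add, integral_const_mul, st, hs]
    · ring
    · exact (hInt _).const_mul _
    · exact hInt2 _
    · exact ((hInt _).const_mul _).add (hInt2 _)
    · exact hInt _
  induction l with
  | zero =>
    constructor
    · simp [HR_zero]
    · rw [step]; simp [HR_zero, HR_succ]
  | succ n ih =>
    refine ⟨ih.2, ?_⟩
    rw [step, ih.2, HR_deriv]
    simp only [Polynomial.eval_smul, smul_eq_mul]
    rw [integral_const_mul, ih.1, HR_succ (n+1), HR_deriv]
    simp
    ring

/-- Mehler-type identity. -/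
lemma mehler (d : ℕ) (hd : 0 < d) (x y : Fin d → ℝ) (hx : dotp x x = d) (hy : dotp y y = d)
    (φ : ℝ → ℝ) (hm : Measurable φ) (hφ : MemLp φ 2 (gaussianReal 0 1)) (l : ℕ) :
    ∫ v, φ (dotp v x) * (HR l).eval (dotp v y) ∂(rowG d)
      = (∫ g, φ g * (HR l).eval g ∂(gaussianReal 0 1)) * (dotp x y / d) ^ l := by
  have hd' : (d : ℝ) ≠ 0 := by positivity
  set ρ := dotp x y / d with hρ
  set w : Fin d → ℝ := y - ρ • x with hw
  have hcov : cov[fun v => dotp v x, fun v => dotp v w; rowG d] = 0 := by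
    rw [rowG_cov, hw, dotp_sub_right, dotp_smul_right, hx, hρ]; field_simp; simp
  have hind := (rowG_pair_gaussian d x w).indepFun_of_covariance_eq_zero hcov
  have hww : dotp w w / d = 1 - ρ ^ 2 := by
    have e1 : dotp w w = dotp w y - ρ * dotp w x := by
      conv_lhs => rw [hw]
      rw [dotp_sub_right, dotp_smul_right, ← hw]
    have e2 : dotp w x = dotp x y - ρ * d := by
      rw [dotp_comm, hw, dotp_sub_right, dotp_smul_right, hx]
    have e3 : dotp w y = d - ρ * dotp x y := by
      rw [dotp_comm, hw, dotp_sub_right, dotp_smul_right, hy, dotp_comm y x]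
    have e4 : dotp x y = ρ * d := by rw [hρ]; field_simp
    rw [e1, e2, e3, e4]; field_simp; ring
  set s : NNReal := (dotp w w / d).toNNReal with hs
  have hs' : (s : ℝ) = 1 - ρ ^ 2 := by
    rw [hs, Real.coe_toNNReal _ (by have := dotp_self_nonneg w; positivity), hww]
  have mA := rowG_map_dotp d x
  have mB := rowG_map_dotp d w
  rw [hx, div_self hd', Real.toNNReal_one] at mA
  rw [← hs] at mB
  have hjoint := (indepFun_iff_map_prod_eq_prod_map_map (by fun_prop) (by fun_prop)).mp hind
  rw [mA, mB] at hjoint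
  have hy' : ∀ v, dotp v y = ρ * dotp v x + dotp v w := by
    intro v; rw [hw, dotp_sub_right, dotp_smul_right]; ring
  -- integrability on the original space
  have mY := rowG_map_dotp d y
  rw [hy, div_self hd', Real.toNNReal_one] at mY
  have hmeas : Measurable (fun p : ℝ × ℝ => φ p.1 * (HR l).eval (ρ * p.1 + p.2)) := by
    refine (hm.comp measurable_fst).mul ?_
    exact ((HR l).continuous.comp (by fun_prop)).measurable
  have hI : Integrable (fun v => φ (dotp v x) * (HR l).eval (dotp v y)) (rowG d) := by
    apply MemLp.integrable_mul (p := 2) (q := 2)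
    · rw [← mA] at hφ
      exact hφ.comp_of_map (by fun_prop)
    · have := poly_memLp_two (HR l) 0 1
      rw [← mY] at this
      exact this.comp_of_map (by fun_prop)
  have hI2 : Integrable (fun p : ℝ × ℝ => φ p.1 * (HR l).eval (ρ * p.1 + p.2))
      ((gaussianReal 0 1).prod (gaussianReal 0 s)) := by
    rw [← hjoint, integrable_map_measure hmeas.aestronglyMeasurable (by fun_prop)]
    refine hI.congr ?_
    filter_upwards with v
    simp [hy' v]
  have e1 : ∫ v, φ (dotp v x) * (HR l).eval (dotp v y) ∂(rowG d)
      = ∫ p, φ p.1 * (HR l).eval (ρ * p.1 + p.2) ∂((gaussianReal 0 1).prod (gaussianReal 0 s)) := by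
    rw [← hjoint, integral_map (by fun_prop) hmeas.aestronglyMeasurable]
    simp [hy']
  rw [e1, integral_prod _ hI2]
  simp only [integral_const_mul, (HR_smooth ρ s hs' _ l).1]
  rw [← integral_mul_const]
  congr 1; ext a; ring

lemma poly_dom (q : Polynomial ℝ) : ∃ R : Polynomial ℝ, (∀ x, |q.eval x| ≤ R.eval x) ∧
    (∀ x y : ℝ, |x| ≤ |y| → R.eval x ≤ R.eval y) := by
  induction q using Polynomial.induction_on' with
  | add p q hp hq =>
    obtain ⟨R, h1, h2⟩ := hp
    obtain ⟨S, h3, h4⟩ := hq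
    refine ⟨R + S, fun x => ?_, fun x y h => ?_⟩
    · simp only [Polynomial.eval_add]
      exact (abs_add_le _ _).trans (add_le_add (h1 x) (h3 x))
    · simp only [Polynomial.eval_add]
      exact add_le_add (h2 x y h) (h4 x y h)
  | monomial n a =>
    refine ⟨Polynomial.C |a| * (1 + Polynomial.X ^ 2) ^ n, fun x => ?_, fun x y h => ?_⟩
    · simp only [Polynomial.eval_monomial, Polynomial.eval_mul, Polynomial.eval_C,
        Polynomial.eval_pow, Polynomial.eval_add, Polynomial.eval_one, Polynomial.eval_X]
      rw [abs_mul, abs_pow]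
      gcongr
      nlinarith [sq_nonneg (|x| - 1), sq_abs x, abs_nonneg x]
    · simp only [Polynomial.eval_mul, Polynomial.eval_C,
        Polynomial.eval_pow, Polynomial.eval_add, Polynomial.eval_one, Polynomial.eval_X]
      have : x ^ 2 ≤ y ^ 2 := sq_le_sq.mpr h
      gcongr

/-- clipping to `[-R, R]` -/
def clip (R c : ℝ) : ℝ := max (-R) (min R c)

lemma clip_abs_le {R : ℝ} (hR : 0 ≤ R) (c : ℝ) : |clip R c| ≤ |R| := by
  rw [abs_of_nonneg hR, abs_le, clip]
  refine ⟨le_max_left _ _, max_le (by linarith) (min_le_left _ _)⟩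

lemma clip_abs_le' {R : ℝ} (hR : 0 ≤ R) (c : ℝ) : |clip R c| ≤ |c| := by
  unfold clip
  rcases max_cases (-R) (min R c) with h | h <;> rcases min_cases R c with h' | h' <;>
  cases abs_cases c <;> rw [abs_le] <;> constructor <;> linarith [h.1, h.2, h'.1, h'.2]

lemma clip_lip (R c c' : ℝ) : |clip R c - clip R c'| ≤ |c - c'| := by
  unfold clip
  refine (abs_max_sub_max_le_max _ _ _ _).trans ?_
  refine max_le (by simp) ((abs_min_sub_min_le_max _ _ _ _).trans (max_le (by simp) le_rfl))

lemma clip_eq {R c : ℝ} (h : |c| ≤ R) : clip R c = c := by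
  rw [abs_le] at h
  unfold clip
  rw [min_eq_right h.2, max_eq_right h.1]

lemma continuous_clip (R : ℝ) : Continuous (clip R) := by unfold clip; fun_prop

lemma test_fn_poly (q : Polynomial ℝ) (ε : ℝ) (hε : 0 < ε) : ∃ g : ℝ → ℝ, ∃ B : ℝ, 0 ≤ B ∧
    (∀ c, |g c| ≤ B) ∧ (∀ c c', |g c - g c'| ≤ B * |c - c'|) ∧
    ∫ c, (g c - q.eval c) ^ 2 ∂(gaussianReal 0 1) ≤ ε ^ 2 := by
  obtain ⟨R, hR1, hR2⟩ := poly_dom q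
  obtain ⟨S, hS1, hS2⟩ := poly_dom q.derivative
  have hlim : Tendsto (fun n : ℕ => ∫ c, (q.eval (clip n c) - q.eval c) ^ 2 ∂(gaussianReal 0 1))
      atTop (nhds (∫ c, (0:ℝ) ∂(gaussianReal 0 1))) := by
    refine tendsto_integral_of_dominated_convergence (fun c => ((2 * R) ^ 2).eval c) ?_ ?_ ?_ ?_
    · intro n
      have : Continuous fun c => (q.eval (clip n c) - q.eval c) ^ 2 :=
        ((q.continuous.comp (continuous_clip n)).sub q.continuous).pow 2
      exact this.aestronglyMeasurable
    · exact poly_integrable _ _ _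
    · intro n
      filter_upwards with c
      rw [Real.norm_eq_abs, abs_pow]
      simp only [Polynomial.eval_pow, Polynomial.eval_mul, Polynomial.eval_ofNat]
      refine pow_le_pow_left₀ (abs_nonneg _) ?_ 2
      have h1 := (hR1 (clip n c)).trans (hR2 _ _ (clip_abs_le' (Nat.cast_nonneg n) c))
      have h2 := hR1 c
      have h3 := abs_sub (q.eval (clip n c)) (q.eval c)
      linarith
    · filter_upwards with c
      refine tendsto_const_nhds.congr' ?_
      filter_upwards [eventually_ge_atTop ⌈|c|⌉₊] with n hn
      rw [clip_eq ((Nat.le_ceil _).trans (by exact_mod_cast hn))]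
      simp
  rw [integral_zero] at hlim
  obtain ⟨n, hn⟩ := (hlim.eventually (ge_mem_nhds (show (0:ℝ) < ε ^ 2 by positivity))).exists
  refine ⟨fun c => q.eval (clip n c), max (R.eval n) (S.eval n), ?_, ?_, ?_, hn⟩
  · exact le_max_of_le_left ((abs_nonneg _).trans (hR1 n))
  · intro c
    exact le_max_of_le_left ((hR1 _).trans (hR2 _ _ (clip_abs_le (Nat.cast_nonneg n) c)))
  · intro c c'
    have hn0 : (0:ℝ) ≤ n := Nat.cast_nonneg n
    have hmem : ∀ c, clip n c ∈ Set.Icc (-(n:ℝ)) n := by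
      intro c
      have := clip_abs_le hn0 c
      rw [abs_of_nonneg hn0, abs_le] at this
      exact this
    have := Convex.norm_image_sub_le_of_norm_hasDerivWithin_le (f := fun x => q.eval x)
      (f' := fun x => q.derivative.eval x) (C := S.eval (n:ℝ))
      (s := Set.Icc (-(n:ℝ)) n) (fun x _ => (q.hasDerivAt x).hasDerivWithinAt)
      (fun x hx => (hS1 x).trans (hS2 _ _ (by
        rw [abs_of_nonneg hn0]; exact abs_le.mpr hx))) (convex_Icc _ _) (hmem c') (hmem c)
    simp only [Real.norm_eq_abs] at this
    refine this.trans ?_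
    have h0 : 0 ≤ S.eval (n:ℝ) := (abs_nonneg _).trans (hS1 n)
    exact mul_le_mul (le_max_right _ _) (clip_lip _ _ _) (abs_nonneg _) (h0.trans (le_max_right _ _))

lemma hermiteFn_eq (l : ℕ) (x : ℝ) :
    hermiteFn l x = (Polynomial.C (√(Nat.factorial l : ℝ))⁻¹ * HR l).eval x := by
  simp [hermiteFn, HR_eval]
  ring

lemma cs_bound {Ω : Type*} [MeasurableSpace Ω] (μ : Measure Ω) (f h : Ω → ℝ) (A B : ℝ) (hA : 0 < A)
    (hB : 0 < B) (hf : MemLp f 2 μ) (hh : MemLp h 2 μ)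
    (h1 : ∫ v, f v ^ 2 ∂μ ≤ A ^ 2) (h2 : ∫ v, h v ^ 2 ∂μ ≤ B ^ 2) : |∫ v, f v * h v ∂μ| ≤ A * B := by
  have hi1 := hf.integrable_sq
  have hi2 := hh.integrable_sq
  have key : ∫ v, |f v * h v| ∂μ ≤ ∫ v, (B / A / 2 * f v ^ 2 + A / B / 2 * h v ^ 2) ∂μ := by
    refine integral_mono (hf.integrable_mul hh).abs ((hi1.const_mul _).add (hi2.const_mul _)) ?_
    intro v
    simp only
    have : B / A / 2 * f v ^ 2 + A / B / 2 * h v ^ 2 - |f v * h v|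
        = (B * |f v| - A * |h v|) ^ 2 / (2 * A * B) := by
      rw [abs_mul, sub_sq, mul_pow, mul_pow, sq_abs, sq_abs]
      field_simp
      ring
    have h3 : 0 ≤ (B * |f v| - A * |h v|) ^ 2 / (2 * A * B) := by positivity
    linarith
  rw [integral_add (hi1.const_mul _) (hi2.const_mul _), integral_const_mul, integral_const_mul]
    at key
  refine (abs_integral_le_integral_abs).trans (key.trans ?_)
  calc _ ≤ B / A / 2 * A ^ 2 + A / B / 2 * B ^ 2 := by gcongr
    _ = A * B := by field_simp; ring

lemma map_std (d : ℕ) (hd : 0 < d) (x : Fin d → ℝ) (hx : dotp x x = d) :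
    (rowG d).map (fun v => dotp v x) = gaussianReal 0 1 := by
  have hd' : (d : ℝ) ≠ 0 := by positivity
  rw [rowG_map_dotp, hx, div_self hd', Real.toNNReal_one]

lemma memLp_lip (φ : ℝ → ℝ) (L : NNReal) (hφ : LipschitzWith L φ) (m : ℝ) (s : NNReal) :
    MemLp φ 2 (gaussianReal m s) := by
  have h00 : MemLp (id : ℝ → ℝ) 2 (gaussianReal m s) := memLp_id_gaussianReal' 2 (by simp)
  have h0 : MemLp (fun x : ℝ => |x|) 2 (gaussianReal m s) := h00.abs
  have hc : MemLp (fun _ : ℝ => |φ 0|) 2 (gaussianReal m s) := memLp_const _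
  have h1 : MemLp (fun x : ℝ => |φ 0| + L * |x|) 2 (gaussianReal m s) :=
    hc.add (h0.const_mul (L : ℝ))
  refine h1.mono hφ.continuous.aestronglyMeasurable ?_
  filter_upwards with x
  have := hφ.dist_le_mul x 0
  rw [Real.dist_eq, Real.dist_eq, sub_zero] at this
  rw [Real.norm_eq_abs, Real.norm_eq_abs, abs_of_nonneg (a := |φ 0| + L * |x|) (by positivity)]
  have h2 := abs_add_le (φ x - φ 0) (φ 0)
  rw [sub_add_cancel] at h2
  linarith

lemma int_dotp_sq (d : ℕ) (u : Fin d → ℝ) : ∫ v, dotp v u ^ 2 ∂(rowG d) = dotp u u / d := by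
  have h := rowG_cov d u u
  rw [covariance_self (by fun_prop), variance_of_integral_eq_zero (by fun_prop)
    (rowG_integral_dotp d u)] at h
  exact h

lemma population (φ : ℝ → ℝ) (L : NNReal) (hφ : LipschitzWith L φ) (l : ℕ) (ε : ℝ) (hε : 0 < ε) :
    ∃ g : ℝ → ℝ, ∃ B : ℝ, 0 ≤ B ∧
    (∀ c, |g c| ≤ B) ∧ (∀ c c', |g c - g c'| ≤ B * |c - c'|) ∧
    ∀ d : ℕ, 0 < d → ∀ x x' y : Fin d → ℝ, dotp x x = d → dotp x' x' = d → dotp y y = d →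
      |∫ v, φ (dotp v x) * g (dotp v y) ∂(rowG d) - hermiteCoeff φ l * (dotp x y / d) ^ l| ≤ ε ∧
      |∫ v, (φ (dotp v x') - φ (dotp v x)) * g (dotp v y) ∂(rowG d)
        - hermiteCoeff φ l * ((dotp x' y / d) ^ l - (dotp x y / d) ^ l)|
        ≤ ε * √(dotp (x' - x) (x' - x) / d) := by
  set N : ℝ := √(∫ c, φ c ^ 2 ∂(gaussianReal 0 1)) + L + 1 with hN
  have hNpos : 0 < N := by positivity
  set q : Polynomial ℝ := Polynomial.C (√(Nat.factorial l : ℝ))⁻¹ * HR l with hq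
  obtain ⟨g, B, hB, hg1, hg2, hg3⟩ := test_fn_poly q (ε / N) (by positivity)
  refine ⟨g, B, hB, hg1, hg2, ?_⟩
  intro d hd x x' y hx hx' hy
  have hd' : (0:ℝ) < d := by exact_mod_cast hd
  have hgc : Continuous g := by
    refine (LipschitzWith.of_dist_le_mul (K := ⟨B, hB⟩) ?_).continuous
    intro a b; exact hg2 a b
  have mφ : ∀ x : Fin d → ℝ, MemLp (fun v => φ (dotp v x)) 2 (rowG d) := by
    intro x
    have := memLp_lip φ L hφ 0 (dotp x x / d).toNNReal
    rw [← rowG_map_dotp] at this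
    exact this.comp_of_map (by fun_prop)
  have mg0 : MemLp g 2 (gaussianReal 0 1) := MemLp.of_bound hgc.aestronglyMeasurable B
    (by filter_upwards with c using hg1 c)
  have mq0 : MemLp (fun c => q.eval c) 2 (gaussianReal 0 1) := poly_memLp_two q 0 1
  have my := map_std d hd y hy
  have mg : MemLp (fun v => g (dotp v y)) 2 (rowG d) := by
    rw [← my] at mg0; exact mg0.comp_of_map (by fun_prop)
  have mq : MemLp (fun v => q.eval (dotp v y)) 2 (rowG d) := by
    rw [← my] at mq0; exact mq0.comp_of_map (by fun_prop)
  have mgq : MemLp (fun v => g (dotp v y) - q.eval (dotp v y)) 2 (rowG d) := mg.sub mq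
  have bgq : ∫ v, (g (dotp v y) - q.eval (dotp v y)) ^ 2 ∂(rowG d) ≤ (ε / N) ^ 2 := by
    have hc : Continuous fun c => (g c - q.eval c) ^ 2 := (hgc.sub q.continuous).pow 2
    have := integral_map (μ := rowG d) (φ := fun v => dotp v y)
      (f := fun c => (g c - q.eval c) ^ 2) (by fun_prop) hc.aestronglyMeasurable
    rw [my] at this
    rw [← this]; exact hg3
  have meh : ∀ x : Fin d → ℝ, dotp x x = d →
      ∫ v, φ (dotp v x) * q.eval (dotp v y) ∂(rowG d) = hermiteCoeff φ l * (dotp x y / d) ^ l := by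
    intro x hx
    have := mehler d hd x y hx hy φ hφ.continuous.measurable (memLp_lip φ L hφ 0 1) l
    have e : ∀ v, φ (dotp v x) * q.eval (dotp v y)
        = (√(Nat.factorial l : ℝ))⁻¹ * (φ (dotp v x) * (HR l).eval (dotp v y)) := by
      intro v; rw [hq]; simp; ring
    simp only [e]
    rw [integral_const_mul, this, ← mul_assoc, hermiteCoeff, ← integral_const_mul]
    congr 2; ext c; rw [hermiteFn_eq]; simp; ring
  have iφg : ∀ x : Fin d → ℝ, Integrable (fun v => φ (dotp v x) * g (dotp v y)) (rowG d) :=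
    fun x => (mφ x).integrable_mul mg
  have iφq : ∀ x : Fin d → ℝ, Integrable (fun v => φ (dotp v x) * q.eval (dotp v y)) (rowG d) :=
    fun x => (mφ x).integrable_mul mq
  constructor
  · rw [← meh x hx, ← integral_sub (iφg x) (iφq x)]
    simp only [← mul_sub]
    refine (cs_bound (rowG d) _ _ N (ε / N) hNpos (by positivity) (mφ x) mgq ?_ bgq).trans
      (le_of_eq (by field_simp))
    have := integral_map (μ := rowG d) (φ := fun v => dotp v x)
      (f := fun c => φ c ^ 2) (by fun_prop) ((hφ.continuous).pow 2).aestronglyMeasurable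
    rw [map_std d hd x hx] at this
    rw [← this]
    have h0 : 0 ≤ ∫ c, φ c ^ 2 ∂(gaussianReal 0 1) := integral_nonneg fun c => sq_nonneg _
    rw [← Real.sq_sqrt h0]
    have : (0:ℝ) ≤ L := L.2
    refine pow_le_pow_left₀ (Real.sqrt_nonneg _) ?_ 2
    rw [hN]; linarith
  · by_cases hxx : dotp (x' - x) (x' - x) = 0
    · have : x' = x := by
        unfold dotp at hxx
        rw [Finset.sum_eq_zero_iff_of_nonneg (fun i _ => mul_self_nonneg _)] at hxx
        ext i
        have := hxx i (Finset.mem_univ _)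
        simp only [Pi.sub_apply, mul_self_eq_zero] at this
        linarith
      subst this
      simp only [sub_self, zero_mul, integral_zero, mul_zero, abs_zero]
      positivity
    have hpos : 0 < dotp (x' - x) (x' - x) := lt_of_le_of_ne (dotp_self_nonneg _) (Ne.symm hxx)
    rw [mul_sub, ← meh x hx, ← meh x' hx', ← integral_sub (iφq x') (iφq x)]
    simp only [← sub_mul]
    have md : MemLp (fun v => φ (dotp v x') - φ (dotp v x)) 2 (rowG d) := (mφ x').sub (mφ x)
    have i1 : Integrable (fun v => (φ (dotp v x') - φ (dotp v x)) * g (dotp v y)) (rowG d) :=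
      md.integrable_mul mg
    have i2 : Integrable (fun v => (φ (dotp v x') - φ (dotp v x)) * q.eval (dotp v y)) (rowG d) :=
      md.integrable_mul mq
    rw [← integral_sub i1 i2]
    simp only [← mul_sub]
    refine (cs_bound (rowG d) _ _ (N * √(dotp (x' - x) (x' - x) / d)) (ε / N) (by positivity)
      (by positivity) md mgq ?_ bgq).trans (le_of_eq (by field_simp))
    have hle : ∀ v, (φ (dotp v x') - φ (dotp v x)) ^ 2 ≤ (L:ℝ) ^ 2 * dotp v (x' - x) ^ 2 := by
      intro v
      have := hφ.dist_le_mul (dotp v x') (dotp v x)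
      rw [Real.dist_eq, Real.dist_eq, ← dotp_sub_right] at this
      rw [← sq_abs, ← sq_abs (dotp v (x' - x)), ← mul_pow]
      exact pow_le_pow_left₀ (abs_nonneg _) this 2
    calc _ ≤ ∫ v, (L:ℝ) ^ 2 * dotp v (x' - x) ^ 2 ∂(rowG d) := by
          refine integral_mono md.integrable_sq ?_ hle
          exact ((rowG_dotp_gaussian d (x' - x)).memLp_two.integrable_sq).const_mul _
      _ = (L:ℝ) ^ 2 * (dotp (x' - x) (x' - x) / d) := by rw [integral_const_mul, int_dotp_sq]
      _ ≤ N ^ 2 * (dotp (x' - x) (x' - x) / d) := by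
          have : (0:ℝ) ≤ L := L.2
          gcongr
          rw [hN]
          have := Real.sqrt_nonneg (∫ c, φ c ^ 2 ∂(gaussianReal 0 1))
          linarith
      _ = _ := by rw [mul_pow, Real.sq_sqrt (by positivity)]

lemma exp_dotp_int (d : ℕ) (hd : 0 < d) (u : Fin d → ℝ) (hu : dotp u u ≤ d) (t : ℝ) :
    Integrable (fun v => Real.exp (t * dotp v u)) (rowG d) ∧
    ∫ v, Real.exp (t * dotp v u) ∂(rowG d) ≤ Real.exp (t ^ 2 / 2) := by
  have hd' : (0:ℝ) < d := by exact_mod_cast hd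
  have h1 := integrable_exp_mul_gaussianReal (μ := 0) (v := (dotp u u / d).toNNReal) t
  rw [← rowG_map_dotp] at h1
  refine ⟨h1.comp_measurable (measurable_dotp_left u), ?_⟩
  have h2 := mgf_gaussianReal (rowG_map_dotp d u) t
  have h3 := dotp_self_nonneg u
  rw [mgf, Real.coe_toNNReal _ (by positivity)] at h2
  rw [h2, zero_mul, zero_add]
  have : dotp u u / d ≤ 1 := by rw [div_le_one hd']; exact hu
  gcongr
  nlinarith [sq_nonneg t]

lemma exp_abs_int (d : ℕ) (hd : 0 < d) (u : Fin d → ℝ) (hu : dotp u u ≤ d) (t : ℝ) :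
    Integrable (fun v => Real.exp (t * |dotp v u|)) (rowG d) ∧
    ∫ v, Real.exp (t * |dotp v u|) ∂(rowG d) ≤ 2 * Real.exp (t ^ 2 / 2) := by
  obtain ⟨i1, b1⟩ := exp_dotp_int d hd u hu t
  obtain ⟨i2, b2⟩ := exp_dotp_int d hd u hu (-t)
  rw [neg_sq] at b2
  have hle : ∀ v, Real.exp (t * |dotp v u|)
      ≤ Real.exp (t * dotp v u) + Real.exp (-t * dotp v u) := by
    intro v
    rcases abs_cases (dotp v u) with h | h <;> rw [h.1]
    · linarith [Real.exp_pos (-t * dotp v u)]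
    · rw [mul_neg, ← neg_mul]; linarith [Real.exp_pos (t * dotp v u)]
  have i3 : Integrable (fun v => Real.exp (t * |dotp v u|)) (rowG d) := by
    refine (i1.add i2).mono' (by fun_prop) ?_
    filter_upwards with v
    rw [Real.norm_eq_abs, abs_of_pos (Real.exp_pos _)]
    exact hle v
  refine ⟨i3, (integral_mono i3 (i1.add i2) hle).trans ?_⟩
  simp only [Pi.add_apply]
  rw [integral_add i1 i2]
  linarith

lemma exp_taylor (x : ℝ) : Real.exp x ≤ 1 + x + x ^ 2 * Real.exp |x| := by
  have h1 := Real.abs_exp_sub_one_sub_id_le (x := x)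
  by_cases hx : |x| ≤ 1
  · have h2 := h1 hx
    have h3 := (abs_le.mp h2).2
    have h4 : 1 ≤ Real.exp |x| := Real.one_le_exp (abs_nonneg x)
    nlinarith [sq_nonneg x]
  · push Not at hx
    rcases abs_cases x with h | h
    · rw [h.1] at hx ⊢
      nlinarith [Real.exp_pos x, mul_pos (sub_pos.mpr hx) (Real.exp_pos x)]
    · rw [h.1] at hx ⊢
      have h5 : Real.exp x ≤ 1 := Real.exp_le_one_iff.mpr h.2.le
      have h6 := Real.add_one_le_exp (-x)
      nlinarith [mul_le_mul_of_nonneg_left h6 (sq_nonneg x)]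

lemma exp_scaled (l w : ℝ) (h0 : 0 ≤ l) (h1 : l ≤ 1) :
    Real.exp (l * w) ≤ 1 + l * w + l ^ 2 * (2 * Real.exp (2 * |w|)) := by
  have h2 := exp_taylor (l * w)
  have h3 : Real.exp |l * w| ≤ Real.exp |w| := by
    apply Real.exp_le_exp.mpr
    rw [abs_mul, abs_of_nonneg h0]
    nlinarith [abs_nonneg w]
  have h4 : w ^ 2 ≤ 2 * Real.exp |w| := by
    have := Real.quadratic_le_exp_of_nonneg (abs_nonneg w)
    rw [sq_abs] at this
    nlinarith [abs_nonneg w]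
  have h5 : (l * w) ^ 2 * Real.exp |l * w| ≤ l ^ 2 * (2 * Real.exp (2 * |w|)) := by
    rw [two_mul |w|, Real.exp_add, mul_pow, mul_assoc]
    refine mul_le_mul_of_nonneg_left ?_ (sq_nonneg l)
    calc w ^ 2 * Real.exp |l * w| ≤ (2 * Real.exp |w|) * Real.exp |w| := by gcongr
      _ = _ := by ring
  linarith

/-- admissible test integrands -/
structure Adm (F : ℝ → ℝ → ℝ → ℝ) (C : ℝ) : Prop where
  pos : 0 < C
  cont : Continuous (fun t : ℝ × ℝ × ℝ => F t.1 t.2.1 t.2.2)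
  bd : ∀ a b c, |F a b c| ≤ C * (1 + |b|)
  lip : ∀ a b c a' b' c', |F a b c - F a' b' c'|
    ≤ C * (1 + |b| + |b'|) * (|a - a'| + |b - b'| + |c - c'|)

lemma Adm.neg {F : ℝ → ℝ → ℝ → ℝ} {C : ℝ} (h : Adm F C) : Adm (fun a b c => - F a b c) C where
  pos := h.pos
  cont := h.cont.neg
  bd := fun a b c => by rw [abs_neg]; exact h.bd a b c
  lip := fun a b c a' b' c' => by
    rw [neg_sub_neg, abs_sub_comm]; exact h.lip a b c a' b' c'

lemma Adm.measurable {F : ℝ → ℝ → ℝ → ℝ} {C : ℝ} (h : Adm F C) {d : ℕ} (z u y : Fin d → ℝ) :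
    Measurable (fun v => F (dotp v z) (dotp v u) (dotp v y)) := by
  have := h.cont.measurable.comp
    ((measurable_dotp_left z).prodMk ((measurable_dotp_left u).prodMk (measurable_dotp_left y)))
  exact this

lemma abs_dotp_int (d : ℕ) (hd : 0 < d) (u : Fin d → ℝ) (hu : dotp u u ≤ d) :
    Integrable (fun v => |dotp v u|) (rowG d) ∧ ∫ v, |dotp v u| ∂(rowG d) ≤ 1 := by
  have hd' : (0:ℝ) < d := by exact_mod_cast hd
  have m2 := (rowG_dotp_gaussian d u).memLp_two
  have i1 : Integrable (fun v => |dotp v u|) (rowG d) := (rowG_dotp_gaussian d u).integrable.abs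
  have i2 : Integrable (fun v => (1 + dotp v u ^ 2) / 2) (rowG d) :=
    ((integrable_const _).add m2.integrable_sq).div_const 2
  refine ⟨i1, ?_⟩
  have := integral_mono i1 i2 (fun v => by
    simp only
    nlinarith [sq_nonneg (|dotp v u| - 1), sq_abs (dotp v u)])
  refine this.trans ?_
  rw [integral_div, integral_add (integrable_const _) m2.integrable_sq, int_dotp_sq]
  have : dotp u u / d ≤ 1 := by rw [div_le_one hd']; exact hu
  simp; linarith

lemma Adm.integrable {F : ℝ → ℝ → ℝ → ℝ} {C : ℝ} (h : Adm F C) {d : ℕ} (hd : 0 < d)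
    (z u y : Fin d → ℝ) (hu : dotp u u ≤ d) :
    Integrable (fun v => F (dotp v z) (dotp v u) (dotp v y)) (rowG d) := by
  refine (((integrable_const 1).add (abs_dotp_int d hd u hu).1).const_mul C).mono'
    (h.measurable z u y).aestronglyMeasurable ?_
  filter_upwards with v
  exact h.bd _ _ _

/-- population mean -/
def EF (F : ℝ → ℝ → ℝ → ℝ) {d : ℕ} (z u y : Fin d → ℝ) : ℝ :=
  ∫ v, F (dotp v z) (dotp v u) (dotp v y) ∂(rowG d)

lemma Adm.mean_bd {F : ℝ → ℝ → ℝ → ℝ} {C : ℝ} (h : Adm F C) {d : ℕ} (hd : 0 < d)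
    (z u y : Fin d → ℝ) (hu : dotp u u ≤ d) : |EF F z u y| ≤ 2 * C := by
  obtain ⟨i, b⟩ := abs_dotp_int d hd u hu
  have h1 : ∫ v, |F (dotp v z) (dotp v u) (dotp v y)| ∂(rowG d)
      ≤ ∫ v, C * (1 + |dotp v u|) ∂(rowG d) :=
    integral_mono (h.integrable hd z u y hu).abs (((integrable_const 1).add i).const_mul C)
      (fun v => h.bd _ _ _)
  rw [integral_const_mul, integral_add (integrable_const 1) i] at h1
  have h2 : |EF F z u y| ≤ _ := abs_integral_le_integral_abs
  refine h2.trans (h1.trans ?_)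
  have := h.pos
  simp
  nlinarith

/-- variance proxy -/
def vp (C : ℝ) : ℝ := 4 * Real.exp (6 * C + 2 * C ^ 2)

lemma Adm.mgf_bd {F : ℝ → ℝ → ℝ → ℝ} {C : ℝ} (h : Adm F C) {d : ℕ} (hd : 0 < d)
    (z u y : Fin d → ℝ) (hu : dotp u u ≤ d) (l : ℝ) (h0 : 0 ≤ l) (h1 : l ≤ 1) :
    Integrable (fun v => Real.exp (l * (F (dotp v z) (dotp v u) (dotp v y) - EF F z u y)))
      (rowG d) ∧
    ∫ v, Real.exp (l * (F (dotp v z) (dotp v u) (dotp v y) - EF F z u y)) ∂(rowG d)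
      ≤ Real.exp (l ^ 2 * vp C) := by
  set W : (Fin d → ℝ) → ℝ := fun v => F (dotp v z) (dotp v u) (dotp v y) - EF F z u y with hW
  have hC := h.pos
  have iF := h.integrable hd z u y hu
  have iW : Integrable W (rowG d) := iF.sub (integrable_const _)
  have eW : ∫ v, W v ∂(rowG d) = 0 := by
    rw [hW, integral_sub iF (integrable_const _)]
    simp [EF]
  have bW : ∀ v, |W v| ≤ C * (3 + |dotp v u|) := by
    intro v
    have := abs_sub (F (dotp v z) (dotp v u) (dotp v y)) (EF F z u y)
    have h2 := h.bd (dotp v z) (dotp v u) (dotp v y)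
    have h3 := h.mean_bd hd z u y hu
    rw [hW]; simp only
    linarith
  obtain ⟨ie, be⟩ := exp_abs_int d hd u hu (2 * C)
  have i2 : Integrable (fun v => 1 + l * W v
      + l ^ 2 * (2 * (Real.exp (6 * C) * Real.exp (2 * C * |dotp v u|)))) (rowG d) :=
    ((integrable_const _).add (iW.const_mul l)).add (((ie.const_mul _).const_mul _).const_mul _)
  have hle : ∀ v, Real.exp (l * W v) ≤ 1 + l * W v
      + l ^ 2 * (2 * (Real.exp (6 * C) * Real.exp (2 * C * |dotp v u|))) := by
    intro v
    refine (exp_scaled l (W v) h0 h1).trans ?_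
    rw [← Real.exp_add]
    gcongr
    linarith [bW v]
  have i1 : Integrable (fun v => Real.exp (l * W v)) (rowG d) := by
    have mW : Measurable W := (h.measurable z u y).sub_const _
    refine i2.mono' (Real.measurable_exp.comp (mW.const_mul l)).aestronglyMeasurable ?_
    filter_upwards with v
    rw [Real.norm_eq_abs, abs_of_pos (Real.exp_pos _)]
    exact hle v
  refine ⟨i1, (integral_mono i1 i2 hle).trans ?_⟩
  have e : ∫ v, (1 + l * W v
      + l ^ 2 * (2 * (Real.exp (6 * C) * Real.exp (2 * C * |dotp v u|)))) ∂(rowG d)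
      = 1 + l ^ 2 * (2 * (Real.exp (6 * C) * ∫ v, Real.exp (2 * C * |dotp v u|) ∂(rowG d))) := by
    have j1 : Integrable (fun v => 1 + l * W v) (rowG d) :=
      (integrable_const 1).add (iW.const_mul l)
    rw [integral_add j1 (((ie.const_mul _).const_mul _).const_mul _),
      integral_add (integrable_const 1) (iW.const_mul l)]
    simp only [integral_const_mul, eW]
    simp
  rw [e]
  have e2 : 1 + l ^ 2 * vp C ≤ Real.exp (l ^ 2 * vp C) := by
    linarith [Real.add_one_le_exp (l ^ 2 * vp C)]
  refine le_trans ?_ e2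
  gcongr
  calc 2 * (Real.exp (6 * C) * ∫ v, Real.exp (2 * C * |dotp v u|) ∂(rowG d))
      ≤ 2 * (Real.exp (6 * C) * (2 * Real.exp ((2 * C) ^ 2 / 2))) := by gcongr
    _ = vp C := by
      rw [vp, Real.exp_add, show (2 * C) ^ 2 / 2 = 2 * C ^ 2 by ring]; ring

/-- empirical mean -/
def AF (F : ℝ → ℝ → ℝ → ℝ) {p d : ℕ} (V : Fin p → Fin d → ℝ) (z u y : Fin d → ℝ) : ℝ :=
  (p : ℝ)⁻¹ * ∑ k, F (dotp (V k) z) (dotp (V k) u) (dotp (V k) y)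

instance (p d : ℕ) : IsProbabilityMeasure (gaussianMatrix p d) := by
  unfold gaussianMatrix; infer_instance

lemma gaussianMatrix_eq (p d : ℕ) : gaussianMatrix p d = Measure.pi fun _ : Fin p => rowG d := rfl

lemma Adm.chernoff {F : ℝ → ℝ → ℝ → ℝ} {C : ℝ} (h : Adm F C) {p d : ℕ} (hd : 0 < d) (hp : 0 < p)
    (z u y : Fin d → ℝ) (hu : dotp u u ≤ d) (l ε : ℝ) (h0 : 0 ≤ l) (h1 : l ≤ 1) :
    gaussianMatrix p d {V | ε ≤ AF F V z u y - EF F z u y}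
      ≤ ENNReal.ofReal (Real.exp (- (l * ε - l ^ 2 * vp C) * p)) := by
  have hp' : (0:ℝ) < p := by exact_mod_cast hp
  obtain ⟨i1, b1⟩ := h.mgf_bd hd z u y hu l h0 h1
  set f : (Fin d → ℝ) → ℝ :=
    fun v => Real.exp (l * (F (dotp v z) (dotp v u) (dotp v y) - EF F z u y)) with hf
  have iP : Integrable (fun V : Fin p → Fin d → ℝ => ∏ k, f (V k)) (gaussianMatrix p d) :=
    Integrable.fintype_prod (f := fun _ => f) (fun _ => i1)
  have eP : ∫ V : Fin p → Fin d → ℝ, ∏ k, f (V k) ∂(gaussianMatrix p d)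
      = (∫ v, f v ∂(rowG d)) ^ p := by
    rw [gaussianMatrix_eq, integral_fintype_prod_eq_prod (f := fun _ : Fin p => f)]
    simp
  have hprod : ∀ V : Fin p → Fin d → ℝ, ∏ k, f (V k)
      = Real.exp (l * p * (AF F V z u y - EF F z u y)) := by
    intro V
    rw [hf, ← Real.exp_sum, ← Finset.mul_sum, Finset.sum_sub_distrib, AF]
    congr 1
    simp
    field_simp
  have hpos : 0 ≤ᵐ[gaussianMatrix p d] (fun V : Fin p → Fin d → ℝ => ∏ k, f (V k)) := by
    filter_upwards with V
    exact Finset.prod_nonneg fun k _ => (Real.exp_pos _).le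
  have mk := mul_meas_ge_le_integral_of_nonneg hpos iP (Real.exp (l * p * ε))
  rw [eP] at mk
  have hsub : {V : Fin p → Fin d → ℝ | ε ≤ AF F V z u y - EF F z u y}
      ⊆ {V | Real.exp (l * p * ε) ≤ ∏ k, f (V k)} := by
    intro V hV
    simp only [Set.mem_ofPred_eq] at hV ⊢
    rw [hprod]
    gcongr
  refine (measure_mono hsub).trans ?_
  rw [← ofReal_measureReal]
  apply ENNReal.ofReal_le_ofReal
  have b2 : (∫ v, f v ∂(rowG d)) ^ p ≤ Real.exp (l ^ 2 * vp C) ^ p := by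
    refine pow_le_pow_left₀ (integral_nonneg fun v => (Real.exp_pos _).le) b1 p
  have b3 := mk.trans b2
  rw [← Real.exp_nat_mul] at b3
  have : Real.exp (- (l * ε - l ^ 2 * vp C) * p)
      = (Real.exp (l * p * ε))⁻¹ * Real.exp (p * (l ^ 2 * vp C)) := by
    rw [← Real.exp_neg, ← Real.exp_add]; congr 1; ring
  rw [this, le_inv_mul_iff₀ (Real.exp_pos _)]
  exact b3

/-- two-sided Chernoff with a uniform rate -/
lemma Adm.chernoff2 {F : ℝ → ℝ → ℝ → ℝ} {C : ℝ} (h : Adm F C) (ε : ℝ) (hε : 0 < ε) :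
    ∃ c : ℝ, 0 < c ∧ ∀ p d : ℕ, 0 < d → 0 < p → ∀ z u y : Fin d → ℝ, dotp u u ≤ d →
    gaussianMatrix p d {V | ε ≤ |AF F V z u y - EF F z u y|}
      ≤ ENNReal.ofReal (2 * Real.exp (- c * p)) := by
  have hM : 0 < vp C := by unfold vp; positivity
  set l := min 1 (ε / (2 * vp C)) with hl
  have hl0 : 0 < l := by positivity
  have hl1 : l ≤ 1 := min_le_left _ _
  have hl2 : l * vp C ≤ ε / 2 := by
    have : l ≤ ε / (2 * vp C) := min_le_right _ _
    rw [le_div_iff₀ (by positivity)] at this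
    linarith
  refine ⟨l * ε / 2, by positivity, ?_⟩
  intro p d hd hp z u y hu
  have hle : Real.exp (- (l * ε - l ^ 2 * vp C) * p) ≤ Real.exp (- (l * ε / 2) * p) := by
    gcongr
    nlinarith
  have a1 := (h.chernoff hd hp z u y hu l ε hl0.le hl1).trans (ENNReal.ofReal_le_ofReal hle)
  have a2 := (h.neg.chernoff hd hp z u y hu l ε hl0.le hl1).trans (ENNReal.ofReal_le_ofReal hle)
  have hsub : {V : Fin p → Fin d → ℝ | ε ≤ |AF F V z u y - EF F z u y|}
      ⊆ {V | ε ≤ AF F V z u y - EF F z u y} ∪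
        {V | ε ≤ AF (fun a b c => - F a b c) V z u y - EF (fun a b c => - F a b c) z u y} := by
    intro V hV
    simp only [Set.mem_ofPred_eq, Set.mem_union] at hV ⊢
    have e1 : AF (fun a b c => - F a b c) V z u y = - AF F V z u y := by
      simp [AF]
    have e2 : EF (fun a b c => - F a b c) z u y = - EF F z u y := by
      simp [EF, integral_neg]
    rw [e1, e2]
    rcases le_abs.mp hV with h | h
    · left; exact h
    · right; linarith
  refine (measure_mono hsub).trans ((measure_union_le _ _).trans ?_)
  rw [two_mul, ENNReal.ofReal_add (Real.exp_pos _).le (Real.exp_pos _).le]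
  exact add_le_add a1 a2

lemma trunc_exists (R x : ℝ) (hR : 0 < R) (N : ℕ) (hN : |x| * R ≤ N) :
    ∃ m : ℤ, |(m : ℝ) / R| ≤ |x| ∧ |x - m / R| ≤ 1 / R ∧ m ∈ Finset.Icc (-(N : ℤ)) N := by
  have key : ∀ t : ℝ, 0 ≤ t → t * R ≤ N → ∃ m : ℤ, 0 ≤ m ∧ (m : ℝ) / R ≤ t ∧ t - m / R ≤ 1 / R ∧
      m ≤ N := by
    intro t ht htN
    refine ⟨⌊t * R⌋, Int.floor_nonneg.mpr (by positivity), ?_, ?_, ?_⟩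
    · rw [div_le_iff₀ hR]; exact Int.floor_le _
    · rw [sub_le_iff_le_add, ← add_div, le_div_iff₀ hR]
      linarith [Int.lt_floor_add_one (t * R)]
    · have := (Int.floor_le (t * R)).trans htN
      exact_mod_cast this
  rcases le_total 0 x with hx | hx
  · rw [abs_of_nonneg hx] at hN
    obtain ⟨m, h0, h1, h2, h3⟩ := key x hx hN
    have h0' : (0:ℝ) ≤ m := by exact_mod_cast h0
    refine ⟨m, ?_, ?_, ?_⟩
    · rw [abs_of_nonneg hx, abs_of_nonneg (by positivity)]; exact h1
    · rw [abs_of_nonneg (by linarith)]; exact h2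
    · rw [Finset.mem_Icc]; omega
  · rw [abs_of_nonpos hx] at hN
    obtain ⟨m, h0, h1, h2, h3⟩ := key (-x) (by linarith) hN
    have h0' : (0:ℝ) ≤ m := by exact_mod_cast h0
    refine ⟨-m, ?_, ?_, ?_⟩
    · push_cast
      rw [neg_div, abs_neg, abs_of_nonpos hx, abs_of_nonneg (by positivity)]; exact h1
    · push_cast
      rw [neg_div, sub_neg_eq_add, abs_of_nonpos (by linarith)]; linarith
    · rw [Finset.mem_Icc]; omega

open Classical in
/-- finite net of the ball of radius `√d` -/
def net (d M : ℕ) : Finset (Fin d → ℝ) :=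
  ((Fintype.piFinset fun _ : Fin d =>
    Finset.Icc (-((d ^ (M + 1) : ℕ) : ℤ)) ((d ^ (M + 1) : ℕ) : ℤ)).image
    (fun m j => (m j : ℝ) / (d : ℝ) ^ M)).filter (fun q => dotp q q ≤ d)

lemma net_card (d M : ℕ) (hd : 0 < d) : (net d M).card ≤ (3 * d ^ (M + 1)) ^ d := by
  unfold net
  refine (Finset.card_filter_le _ _).trans (Finset.card_image_le.trans ?_)
  rw [Fintype.card_piFinset]
  simp only [Int.card_Icc, Finset.prod_const, Finset.card_univ, Fintype.card_fin]
  refine Nat.pow_le_pow_left ?_ d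
  have : 1 ≤ d ^ (M + 1) := Nat.one_le_pow _ _ hd
  omega

lemma coord_le (d : ℕ) (x : Fin d → ℝ) (hx : dotp x x ≤ d) (j : Fin d) : |x j| ≤ d := by
  have hd : (1:ℝ) ≤ d := by
    have := j.pos
    exact_mod_cast this
  have h1 : x j * x j ≤ dotp x x :=
    Finset.single_le_sum (f := fun j => x j * x j) (fun i _ => mul_self_nonneg _)
      (Finset.mem_univ j)
  apply abs_le_of_sq_le_sq _ (by linarith)
  nlinarith

lemma net_cover (d M : ℕ) (hd : 0 < d) (x : Fin d → ℝ) (hx : dotp x x ≤ d) :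
    ∃ q ∈ net d M, ∀ j, |x j - q j| ≤ 1 / (d : ℝ) ^ M := by
  have hd' : (0:ℝ) < d := by exact_mod_cast hd
  have hex : ∀ j, ∃ m : ℤ, |(m : ℝ) / (d : ℝ) ^ M| ≤ |x j| ∧ |x j - m / (d : ℝ) ^ M| ≤ 1 / (d : ℝ) ^ M
      ∧ m ∈ Finset.Icc (-((d ^ (M + 1) : ℕ) : ℤ)) ((d ^ (M + 1) : ℕ) : ℤ) := by
    intro j
    refine trunc_exists ((d : ℝ) ^ M) (x j) (by positivity) (d ^ (M + 1)) ?_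
    have := coord_le d x hx j
    push_cast
    rw [pow_succ']
    gcongr
  choose m h1 h2 h3 using hex
  refine ⟨fun j => (m j : ℝ) / (d : ℝ) ^ M, ?_, h2⟩
  unfold net
  rw [Finset.mem_filter]
  refine ⟨Finset.mem_image.mpr ⟨m, Fintype.mem_piFinset.mpr h3, rfl⟩, le_trans ?_ hx⟩
  refine Finset.sum_le_sum fun j _ => ?_
  have := sq_le_sq.mpr (h1 j)
  nlinarith

lemma net_ball {d M : ℕ} {q : Fin d → ℝ} (hq : q ∈ net d M) : dotp q q ≤ d := by
  unfold net at hq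
  exact (Finset.mem_filter.mp hq).2

/-- `ℓ¹` size -/
def S1 {d : ℕ} (v : Fin d → ℝ) : ℝ := ∑ j, |v j|

lemma S1_nonneg {d : ℕ} (v : Fin d → ℝ) : 0 ≤ S1 v := Finset.sum_nonneg fun _ _ => abs_nonneg _

lemma continuous_S1 {d : ℕ} : Continuous (S1 : (Fin d → ℝ) → ℝ) := by unfold S1; fun_prop

lemma dotp_le_S1 {d : ℕ} (v x : Fin d → ℝ) (r : ℝ) (hx : ∀ j, |x j| ≤ r) :
    |dotp v x| ≤ r * S1 v := by
  unfold dotp S1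
  rw [Finset.mul_sum]
  refine (Finset.abs_sum_le_sum_abs _ _).trans (Finset.sum_le_sum fun j _ => ?_)
  rw [abs_mul, mul_comm]
  exact mul_le_mul_of_nonneg_right (hx j) (abs_nonneg _)

lemma S1_sq_int (d : ℕ) (hd : 0 < d) : Integrable (fun v : Fin d → ℝ => (1 + S1 v) ^ 2) (rowG d) ∧
    ∫ v, (1 + S1 v) ^ 2 ∂(rowG d) ≤ 4 * (d : ℝ) := by
  have hd' : (1:ℝ) ≤ d := by exact_mod_cast hd
  have isq : ∀ j : Fin d, Integrable (fun v : Fin d → ℝ => v j ^ 2) (rowG d) :=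
    fun j => (rowG_eval_gaussian d j).memLp_two.integrable_sq
  have esq : ∀ j : Fin d, ∫ v : Fin d → ℝ, v j ^ 2 ∂(rowG d) = (d:ℝ)⁻¹ := by
    intro j
    rw [← rowG_var_eval d j, variance_of_integral_eq_zero (measurable_pi_apply j).aemeasurable
      (rowG_integral_eval d j)]
  have isum : Integrable (fun v : Fin d → ℝ => ∑ j, v j ^ 2) (rowG d) :=
    integrable_finsetSum _ fun j _ => isq j
  have i2 : Integrable (fun v : Fin d → ℝ => 2 + 2 * d * ∑ j, v j ^ 2) (rowG d) :=
    (integrable_const _).add (isum.const_mul _)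
  have hle : ∀ v : Fin d → ℝ, (1 + S1 v) ^ 2 ≤ 2 + 2 * d * ∑ j, v j ^ 2 := by
    intro v
    have h1 := sq_sum_le_card_mul_sum_sq (s := Finset.univ) (f := fun j => |v j|)
    simp only [sq_abs, Finset.card_univ, Fintype.card_fin] at h1
    have h2 : S1 v ^ 2 ≤ d * ∑ j, v j ^ 2 := h1
    nlinarith [sq_nonneg (S1 v - 1)]
  have i1 : Integrable (fun v : Fin d → ℝ => (1 + S1 v) ^ 2) (rowG d) := by
    refine i2.mono' ((continuous_const.add continuous_S1).pow 2).aestronglyMeasurable ?_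
    filter_upwards with v
    rw [Real.norm_eq_abs, abs_of_nonneg (sq_nonneg _)]
    exact hle v
  refine ⟨i1, (integral_mono i1 i2 hle).trans ?_⟩
  rw [integral_add (integrable_const _) (isum.const_mul _), integral_const_mul,
    integral_finsetSum _ fun j _ => isq j]
  simp only [esq]
  simp
  field_simp
  linarith

lemma Adm.lip_net {F : ℝ → ℝ → ℝ → ℝ} {C : ℝ} (h : Adm F C) {d : ℕ} (hd : 0 < d) (δ : ℝ)
    (hδ : 0 ≤ δ) (z u y z' u' y' v : Fin d → ℝ) (hu : dotp u u ≤ d) (hu' : dotp u' u' ≤ d)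
    (hz : ∀ j, |z j - z' j| ≤ δ) (huu : ∀ j, |u j - u' j| ≤ δ) (hy : ∀ j, |y j - y' j| ≤ δ) :
    |F (dotp v z) (dotp v u) (dotp v y) - F (dotp v z') (dotp v u') (dotp v y')|
      ≤ 6 * C * d * δ * (1 + S1 v) ^ 2 := by
  have hC := h.pos
  have hd' : (1:ℝ) ≤ d := by exact_mod_cast hd
  have hS := S1_nonneg v
  refine (h.lip _ _ _ _ _ _).trans ?_
  rw [← dotp_sub_right, ← dotp_sub_right, ← dotp_sub_right]
  have a1 := dotp_le_S1 v (z - z') δ hz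
  have a2 := dotp_le_S1 v (u - u') δ huu
  have a3 := dotp_le_S1 v (y - y') δ hy
  have a4 := dotp_le_S1 v u d (coord_le d u hu)
  have a5 := dotp_le_S1 v u' d (coord_le d u' hu')
  calc _ ≤ C * (1 + d * S1 v + d * S1 v) * (δ * S1 v + δ * S1 v + δ * S1 v) := by gcongr
    _ ≤ C * (2 * d * (1 + S1 v)) * (3 * δ * (1 + S1 v)) := by
        gcongr
        · nlinarith
        · nlinarith
    _ = _ := by ring

lemma S1_markov (p d m : ℕ) (hd : 0 < d) (hp : 0 < p) :
    gaussianMatrix p d {V | (d:ℝ) ^ m ≤ (p:ℝ)⁻¹ * ∑ k, (1 + S1 (V k)) ^ 2}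
      ≤ ENNReal.ofReal (4 * d / (d:ℝ) ^ m) := by
  have hd' : (0:ℝ) < d := by exact_mod_cast hd
  have hp' : (0:ℝ) < p := by exact_mod_cast hp
  obtain ⟨i1, b1⟩ := S1_sq_int d hd
  have mp : ∀ k : Fin p, MeasurePreserving (fun V : Fin p → Fin d → ℝ => V k) (gaussianMatrix p d)
      (rowG d) := fun k => measurePreserving_eval (fun _ : Fin p => rowG d) k
  have ik : ∀ k : Fin p, Integrable (fun V : Fin p → Fin d → ℝ => (1 + S1 (V k)) ^ 2)
      (gaussianMatrix p d) := fun k => (mp k).integrable_comp_of_integrable i1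
  have ek : ∀ k : Fin p, ∫ V : Fin p → Fin d → ℝ, (1 + S1 (V k)) ^ 2 ∂(gaussianMatrix p d)
      = ∫ v, (1 + S1 v) ^ 2 ∂(rowG d) := by
    intro k
    rw [← (mp k).map_eq, integral_map (measurable_pi_apply k).aemeasurable
      ((continuous_const.add continuous_S1).pow 2).aestronglyMeasurable]
  have it : Integrable (fun V : Fin p → Fin d → ℝ => (p:ℝ)⁻¹ * ∑ k, (1 + S1 (V k)) ^ 2)
      (gaussianMatrix p d) := (integrable_finsetSum _ fun k _ => ik k).const_mul _
  have mk := mul_meas_ge_le_integral_of_nonneg (by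
    filter_upwards with V
    simp only [Pi.zero_apply]
    positivity) it ((d:ℝ) ^ m)
  rw [integral_const_mul, integral_finsetSum _ fun k _ => ik k] at mk
  simp only [ek] at mk
  rw [← ofReal_measureReal]
  apply ENNReal.ofReal_le_ofReal
  rw [le_div_iff₀ (by positivity), mul_comm]
  refine mk.trans (le_trans (le_of_eq ?_) b1)
  simp
  field_simp

/-- The generic uniform concentration, finite `d`. -/
lemma Adm.uniform_fin {F : ℝ → ℝ → ℝ → ℝ} {C : ℝ} (h : Adm F C) (ε : ℝ) (hε : 0 < ε) :
    ∃ c : ℝ, 0 < c ∧ ∀ p d m : ℕ, 0 < d → 0 < p → 60 * C ≤ ε * d → 1 ≤ m →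
    gaussianMatrix p d {V | ¬ ∀ z u y : Fin d → ℝ, dotp z z ≤ d → dotp u u ≤ d → dotp y y ≤ d →
        |AF F V z u y - EF F z u y| ≤ ε}
      ≤ ENNReal.ofReal (4 * d / (d:ℝ) ^ m)
        + ENNReal.ofReal ((3 * (d:ℝ) ^ (m + 3)) ^ (3 * d) * (2 * Real.exp (- c * p))) := by
  obtain ⟨c, hc, hcher⟩ := h.chernoff2 (ε / 2) (by positivity)
  refine ⟨c, hc, ?_⟩
  intro p d m hd hp hCd hm
  have hC := h.pos
  have hd' : (1:ℝ) ≤ d := by exact_mod_cast hd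
  have hp' : (0:ℝ) < p := by exact_mod_cast hp
  set N := net d (m + 2) with hN
  set T : Finset ((Fin d → ℝ) × (Fin d → ℝ) × (Fin d → ℝ)) := N ×ˢ N ×ˢ N with hT
  have hsub : {V : Fin p → Fin d → ℝ | ¬ ∀ z u y : Fin d → ℝ, dotp z z ≤ d → dotp u u ≤ d →
        dotp y y ≤ d → |AF F V z u y - EF F z u y| ≤ ε}
      ⊆ {V | (d:ℝ) ^ m ≤ (p:ℝ)⁻¹ * ∑ k, (1 + S1 (V k)) ^ 2} ∪
        ⋃ t ∈ T, {V | ε / 2 ≤ |AF F V t.1 t.2.1 t.2.2 - EF F t.1 t.2.1 t.2.2|} := by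
    intro V hV
    by_contra hcon
    rw [Set.mem_union, not_or] at hcon
    obtain ⟨h1, h2⟩ := hcon
    simp only [Set.mem_ofPred_eq, not_le] at h1
    simp only [Set.mem_iUnion, Set.mem_ofPred_eq, not_exists, not_le] at h2
    apply hV
    intro z u y hz hu hy
    obtain ⟨z', hz', dz⟩ := net_cover d (m + 2) hd z hz
    obtain ⟨u', hu', du⟩ := net_cover d (m + 2) hd u hu
    obtain ⟨y', hy', dy⟩ := net_cover d (m + 2) hd y hy
    have b0 := h2 (z', u', y') (by
      rw [hT, Finset.mem_product, Finset.mem_product]; exact ⟨hz', hu', hy'⟩)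
    simp only at b0
    set δ : ℝ := 1 / (d:ℝ) ^ (m + 2) with hδ
    have hδ0 : 0 ≤ δ := by positivity
    have hl := fun v => h.lip_net hd δ hδ0 z u y z' u' y' v hu (net_ball hu') dz du dy
    have b1 : |AF F V z u y - AF F V z' u' y'| ≤ 6 * C * d * δ * (d:ℝ) ^ m := by
      unfold AF
      rw [← mul_sub, ← Finset.sum_sub_distrib, abs_mul, abs_of_pos (by positivity : (0:ℝ) < (p:ℝ)⁻¹)]
      calc _ ≤ (p:ℝ)⁻¹ * ∑ k, 6 * C * d * δ * (1 + S1 (V k)) ^ 2 := by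
            gcongr
            exact (Finset.abs_sum_le_sum_abs _ _).trans (Finset.sum_le_sum fun k _ => hl (V k))
        _ = 6 * C * d * δ * ((p:ℝ)⁻¹ * ∑ k, (1 + S1 (V k)) ^ 2) := by
            rw [← Finset.mul_sum]; ring
        _ ≤ _ := by gcongr
    have b2 : |EF F z u y - EF F z' u' y'| ≤ 6 * C * d * δ * (4 * d) := by
      obtain ⟨i1, s1⟩ := S1_sq_int d hd
      unfold EF
      rw [← integral_sub (h.integrable hd z u y hu) (h.integrable hd z' u' y' (net_ball hu'))]
      refine abs_integral_le_integral_abs.trans ?_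
      refine (integral_mono ((h.integrable hd z u y hu).sub
        (h.integrable hd z' u' y' (net_ball hu'))).abs (i1.const_mul (6 * C * d * δ)) hl).trans ?_
      rw [integral_const_mul]
      gcongr
    have c1 : 6 * C * d * δ * (d:ℝ) ^ m ≤ 6 * C / d := by
      rw [hδ, pow_add]; apply le_of_eq; field_simp
    have c2 : 6 * C * d * δ * (4 * d) ≤ 24 * C / d := by
      have : d * δ * d ≤ 1 / d := by
        rw [hδ, pow_add]
        have : (d:ℝ) ≤ (d:ℝ) ^ m := le_self_pow₀ hd' (by omega)
        rw [mul_one_div, div_mul_eq_mul_div, div_le_div_iff₀ (by positivity) (by positivity)]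
        nlinarith [mul_le_mul_of_nonneg_right this (sq_nonneg (d:ℝ))]
      calc 6 * C * d * δ * (4 * d) = 24 * C * (d * δ * d) := by ring
        _ ≤ 24 * C * (1 / d) := by gcongr
        _ = _ := by ring
    have c3 : 6 * C / d + 24 * C / d ≤ ε / 2 := by
      rw [← add_div, div_le_iff₀ (by linarith)]; linarith
    have e : AF F V z u y - EF F z u y = (AF F V z u y - AF F V z' u' y')
      + (AF F V z' u' y' - EF F z' u' y') + (-(EF F z u y - EF F z' u' y')) := by ring
    rw [e]
    refine (abs_add_three _ _ _).trans ?_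
    rw [abs_neg]
    linarith
  refine (measure_mono hsub).trans ((measure_union_le _ _).trans ?_)
  refine add_le_add (S1_markov p d m hd hp) ?_
  refine (measure_biUnion_finset_le _ _).trans ?_
  refine (Finset.sum_le_card_nsmul _ _ (ENNReal.ofReal (2 * Real.exp (- c * p))) ?_).trans ?_
  · intro t ht
    rw [hT, Finset.mem_product, Finset.mem_product] at ht
    exact hcher p d hd hp _ _ _ (net_ball ht.2.1)
  · rw [nsmul_eq_mul, ENNReal.ofReal_mul (p := (3 * (d:ℝ) ^ (m + 3)) ^ (3 * d)) (by positivity)]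
    refine mul_le_mul' ?_ le_rfl
    have hcard : T.card ≤ (3 * d ^ (m + 3)) ^ (3 * d) := by
      rw [hT, Finset.card_product, Finset.card_product, mul_comm 3 d, pow_mul, pow_three]
      have := net_card d (m + 2) hd
      gcongr
    rw [← ENNReal.ofReal_natCast]
    apply ENNReal.ofReal_le_ofReal
    exact_mod_cast hcard

/-- decays faster than any polynomial in `d` -/
def Negl (f : ℕ → ENNReal) : Prop :=
  ∀ k : ℝ, 0 < k → ∀ᶠ d : ℕ in atTop, f d ≤ ENNReal.ofReal ((d:ℝ) ^ (-k))

lemma two_rpow_le (k : ℝ) : ∀ᶠ d : ℕ in atTop,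
    ENNReal.ofReal ((d:ℝ) ^ (-(k + 1))) + ENNReal.ofReal ((d:ℝ) ^ (-(k + 1)))
      ≤ ENNReal.ofReal ((d:ℝ) ^ (-k)) := by
  filter_upwards [eventually_ge_atTop 2] with d hd
  have hd' : (2:ℝ) ≤ d := by exact_mod_cast hd
  have h0 : 0 ≤ (d:ℝ) ^ (-(k + 1)) := by positivity
  rw [← ENNReal.ofReal_add h0 h0]
  apply ENNReal.ofReal_le_ofReal
  have : (d:ℝ) ^ (-k) = (d:ℝ) ^ (-(k + 1)) * d := by
    rw [← Real.rpow_add_one (by positivity)]; congr 1; ring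
  rw [this]
  nlinarith

lemma Negl.add {f g : ℕ → ENNReal} (hf : Negl f) (hg : Negl g) : Negl (fun d => f d + g d) := by
  intro k hk
  filter_upwards [hf (k + 1) (by linarith), hg (k + 1) (by linarith), two_rpow_le k] with d h1 h2 h3
  exact (add_le_add h1 h2).trans h3

lemma Negl.mono {f g : ℕ → ENNReal} (hf : Negl f) (h : ∀ᶠ d in atTop, g d ≤ f d) : Negl g := by
  intro k hk
  filter_upwards [hf k hk, h] with d h1 h2
  exact h2.trans h1

lemma log_tendsto : Tendsto (fun d : ℕ => Real.log d) atTop atTop :=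
  Real.tendsto_log_atTop.comp tendsto_natCast_atTop_atTop

lemma Adm.uniform {F : ℝ → ℝ → ℝ → ℝ} {C : ℝ} (h : Adm F C) (p : ℕ → ℕ)
    (hp : Tendsto (fun d : ℕ => (p d : ℝ) / ((d : ℝ) * (Real.log d) ^ 2)) atTop atTop)
    (ε : ℝ) (hε : 0 < ε) :
    Negl (fun d => gaussianMatrix (p d) d {V | ¬ ∀ z u y : Fin d → ℝ, dotp z z ≤ d → dotp u u ≤ d →
      dotp y y ≤ d → |AF F V z u y - EF F z u y| ≤ ε}) := by
  intro k hk
  obtain ⟨c, hc, hu⟩ := h.uniform_fin ε hε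
  set m : ℕ := ⌈k⌉₊ + 3 with hm
  have hmk : k + 3 ≤ (m:ℝ) := by
    rw [hm]; push_cast; linarith [Nat.le_ceil k]
  filter_upwards [two_rpow_le k, hp.eventually_ge_atTop 1, eventually_ge_atTop 4,
    log_tendsto.eventually_ge_atTop 1,
    log_tendsto.eventually_ge_atTop ((6 + 3 * ((m:ℝ) + 3) + 1 + (k + 1)) / c),
    tendsto_natCast_atTop_atTop.eventually_ge_atTop (60 * C / ε)] with d h1 h2 h3 h4 h5 h6
  have hd4 : (4:ℝ) ≤ d := by exact_mod_cast h3
  have hd0 : (0:ℝ) < d := by linarith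
  set t := Real.log d with ht
  have hpt : d * t ^ 2 ≤ p d := by
    rw [le_div_iff₀ (by positivity)] at h2; linarith
  have hp0 : 0 < p d := by
    have : (0:ℝ) < p d := lt_of_lt_of_le (by positivity) hpt
    exact_mod_cast this
  have hexp : (d:ℝ) = Real.exp t := (Real.exp_log hd0).symm
  refine (hu (p d) d m (by omega) hp0 ?_ (by omega)).trans ((add_le_add ?_ ?_).trans h1)
  · rw [div_le_iff₀ hε] at h6; linarith
  · apply ENNReal.ofReal_le_ofReal
    rw [div_le_iff₀ (by positivity), ← Real.rpow_natCast, ← Real.rpow_add hd0]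
    calc 4 * (d:ℝ) ≤ d * d := by gcongr
      _ = (d:ℝ) ^ (2:ℝ) := by norm_num; ring
      _ ≤ _ := Real.rpow_le_rpow_of_exponent_le (by linarith) (by linarith)
  · apply ENNReal.ofReal_le_ofReal
    have e1 : 3 * (d:ℝ) ^ (m + 3) ≤ Real.exp (2 + (m + 3) * t) := by
      have h3e : (3:ℝ) ≤ Real.exp 2 := by linarith [Real.add_one_le_exp (2:ℝ)]
      rw [Real.exp_add]
      have : (d:ℝ) ^ (m + 3) = Real.exp ((m + 3) * t) := by
        conv_lhs => rw [hexp]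
        rw [← Real.exp_nat_mul]; push_cast; ring_nf
      rw [this]
      gcongr
    have e2 : (2:ℝ) ≤ Real.exp 1 := by linarith [Real.add_one_le_exp (1:ℝ)]
    calc (3 * (d:ℝ) ^ (m + 3)) ^ (3 * d) * (2 * Real.exp (- c * p d))
        ≤ (Real.exp (2 + (m + 3) * t)) ^ (3 * d) * (Real.exp 1 * Real.exp (- c * p d)) := by gcongr
      _ = Real.exp ((3 * d) * (2 + (m + 3) * t) + (1 + - c * p d)) := by
          rw [← Real.exp_nat_mul, ← Real.exp_add, ← Real.exp_add]; push_cast; ring_nf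
      _ ≤ Real.exp (t * -(k + 1)) := by
          rw [div_le_iff₀ hc] at h5
          gcongr
          set Q := 6 + 3 * ((m:ℝ) + 3) + 1 + (k + 1) with hQ
          have hm0 : (0:ℝ) ≤ m := Nat.cast_nonneg m
          have q1 : c * (d * t ^ 2) ≤ c * p d := by gcongr
          have q2 : Q * t ≤ c * t ^ 2 := by nlinarith
          have q3 : d * (Q * t) ≤ d * (c * t ^ 2) := by gcongr
          have q4 : 6 + (3 * (m + 3)) * t + (1 + (k + 1) * t) ≤ Q * t := by rw [hQ]; nlinarith
          have q5 : d * (6 + (3 * (m + 3)) * t + (1 + (k + 1) * t)) ≤ d * (Q * t) := by gcongr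
          have q6 : 1 + (k + 1) * t ≤ d * (1 + (k + 1) * t) :=
            le_mul_of_one_le_left (by positivity) (by linarith)
          nlinarith
      _ = (d:ℝ) ^ (-(k + 1)) := by rw [Real.rpow_def_of_pos hd0]

/-- integrand for the values -/
def FA (φ g : ℝ → ℝ) : ℝ → ℝ → ℝ → ℝ := fun _ b c => φ b * g c

/-- integrand for the derivatives -/
def FB (φ g : ℝ → ℝ) : ℝ → ℝ → ℝ → ℝ := fun a b c => deriv φ a * b * g c

lemma continuous_of_lip {g : ℝ → ℝ} {B : ℝ} (hB : 0 ≤ B)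
    (hg2 : ∀ c c', |g c - g c'| ≤ B * |c - c'|) : Continuous g := by
  refine (LipschitzWith.of_dist_le_mul (K := ⟨B, hB⟩) ?_).continuous
  intro a b; exact hg2 a b

lemma adm_FA {φ g : ℝ → ℝ} {L B : ℝ} (hL : 0 ≤ L) (hB : 0 ≤ B)
    (hφ : ∀ c c', |φ c - φ c'| ≤ L * |c - c'|)
    (hg1 : ∀ c, |g c| ≤ B) (hg2 : ∀ c c', |g c - g c'| ≤ B * |c - c'|) :
    Adm (FA φ g) ((|φ 0| + L + 1) * (B + 1)) := by
  set A := |φ 0| + L + 1 with hA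
  have hA0 : 0 ≤ |φ 0| := abs_nonneg _
  have hApos : 0 < A := by positivity
  have hb : ∀ b, |φ b| ≤ A * (1 + |b|) := by
    intro b
    have h1 := hφ b 0
    have h2 := abs_add_le (φ b - φ 0) (φ 0)
    rw [sub_add_cancel] at h2
    rw [sub_zero] at h1
    have := abs_nonneg b
    rw [hA]
    nlinarith [mul_nonneg hA0 this]
  have cφ := continuous_of_lip hL hφ
  have cg := continuous_of_lip hB hg2
  refine ⟨by positivity, ?_, ?_, ?_⟩
  · unfold FA; fun_prop
  · intro a b c
    unfold FA
    rw [abs_mul]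
    calc |φ b| * |g c| ≤ (A * (1 + |b|)) * (B + 1) := by
          gcongr
          · exact hb b
          · linarith [hg1 c]
      _ = _ := by ring
  · intro a b c a' b' c'
    unfold FA
    have e : φ b * g c - φ b' * g c' = (φ b - φ b') * g c + φ b' * (g c - g c') := by ring
    rw [e]
    refine (abs_add_le _ _).trans ?_
    rw [abs_mul, abs_mul]
    have i1 : |φ b - φ b'| * |g c| ≤ (A * |b - b'|) * (B + 1) := by
      gcongr
      · refine (hφ b b').trans ?_
        gcongr
        rw [hA]; linarith
      · linarith [hg1 c]
    have i2 : |φ b'| * |g c - g c'| ≤ (A * (1 + |b'|)) * ((B + 1) * |c - c'|) := by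
      gcongr
      · exact hb b'
      · refine (hg2 c c').trans ?_
        gcongr
        linarith
    have n1 := abs_nonneg b
    have n2 := abs_nonneg b'
    have n3 := abs_nonneg (a - a')
    have n4 := abs_nonneg (b - b')
    have n5 := abs_nonneg (c - c')
    calc _ ≤ A * (B + 1) * (|b - b'| + (1 + |b'|) * |c - c'|) := by linarith
      _ ≤ A * (B + 1) * ((1 + |b| + |b'|) * (|a - a'| + |b - b'| + |c - c'|)) := by
          gcongr
          nlinarith [mul_nonneg n1 n4, mul_nonneg n2 n4, mul_nonneg n1 n5, mul_nonneg n2 n3,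
            mul_nonneg n1 n3]
      _ = _ := by ring

lemma adm_FB {φ g : ℝ → ℝ} {L B : ℝ} (hL : 0 ≤ L) (hB : 0 ≤ B)
    (hφ1 : ∀ c, |deriv φ c| ≤ L)
    (hφ : ∀ c c', |deriv φ c - deriv φ c'| ≤ L * |c - c'|)
    (hg1 : ∀ c, |g c| ≤ B) (hg2 : ∀ c c', |g c - g c'| ≤ B * |c - c'|) :
    Adm (FB φ g) ((L + 1) * (B + 1)) := by
  have cφ := continuous_of_lip hL hφ
  have cg := continuous_of_lip hB hg2
  refine ⟨by positivity, ?_, ?_, ?_⟩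
  · unfold FB; fun_prop
  · intro a b c
    unfold FB
    rw [abs_mul, abs_mul]
    calc |deriv φ a| * |b| * |g c| ≤ (L + 1) * (1 + |b|) * (B + 1) := by
          gcongr
          · linarith [hφ1 a]
          · linarith
          · linarith [hg1 c]
      _ = _ := by ring
  · intro a b c a' b' c'
    unfold FB
    have e : deriv φ a * b * g c - deriv φ a' * b' * g c' = (deriv φ a - deriv φ a') * b * g c
      + deriv φ a' * (b - b') * g c + deriv φ a' * b' * (g c - g c') := by ring
    rw [e]
    refine (abs_add_three _ _ _).trans ?_
    simp only [abs_mul]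
    have n1 := abs_nonneg b
    have n2 := abs_nonneg b'
    have n3 := abs_nonneg (a - a')
    have n4 := abs_nonneg (b - b')
    have n5 := abs_nonneg (c - c')
    have i1 : |deriv φ a - deriv φ a'| * |b| * |g c| ≤ ((L + 1) * |a - a'|) * |b| * (B + 1) := by
      gcongr
      · exact (hφ a a').trans (by gcongr; linarith)
      · linarith [hg1 c]
    have i2 : |deriv φ a'| * |b - b'| * |g c| ≤ (L + 1) * |b - b'| * (B + 1) := by
      gcongr
      · linarith [hφ1 a']
      · linarith [hg1 c]
    have i3 : |deriv φ a'| * |b'| * |g c - g c'| ≤ (L + 1) * |b'| * ((B + 1) * |c - c'|) := by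
      gcongr
      · linarith [hφ1 a']
      · exact (hg2 c c').trans (by gcongr; linarith)
    calc _ ≤ (L + 1) * (B + 1) * (|a - a'| * |b| + |b - b'| + |b'| * |c - c'|) := by linarith
      _ ≤ (L + 1) * (B + 1) * ((1 + |b| + |b'|) * (|a - a'| + |b - b'| + |c - c'|)) := by
          gcongr
          nlinarith [mul_nonneg n1 n4, mul_nonneg n2 n4, mul_nonneg n1 n5, mul_nonneg n2 n3,
            mul_nonneg n1 n3]
      _ = _ := by ring

lemma ball_convex {d : ℕ} (x w : Fin d → ℝ) (hx : dotp x x ≤ d) (hx' : dotp (x + w) (x + w) ≤ d)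
    (s : ℝ) (h0 : 0 ≤ s) (h1 : s ≤ 1) : dotp (x + s • w) (x + s • w) ≤ d := by
  have : dotp (x + s • w) (x + s • w) ≤ (1 - s) * dotp x x + s * dotp (x + w) (x + w) := by
    unfold dotp
    rw [Finset.mul_sum, Finset.mul_sum, ← Finset.sum_add_distrib]
    refine Finset.sum_le_sum fun j _ => ?_
    simp only [Pi.add_apply, Pi.smul_apply, smul_eq_mul]
    nlinarith [mul_nonneg (mul_nonneg h0 (sub_nonneg.mpr h1)) (sq_nonneg (w j))]
  nlinarith

lemma dotp_self_eq_zero {d : ℕ} (w : Fin d → ℝ) (h : dotp w w = 0) : w = 0 := by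
  unfold dotp at h
  rw [Finset.sum_eq_zero_iff_of_nonneg (fun i _ => mul_self_nonneg _)] at h
  ext i
  have := h i (Finset.mem_univ _)
  simpa using this

lemma diff_bound {φ g : ℝ → ℝ} {L B : ℝ} (hL : 0 ≤ L) (hB : 0 ≤ B) (hdiff : Differentiable ℝ φ)
    (hφ0 : ∀ c c', |φ c - φ c'| ≤ L * |c - c'|)
    (hφ1 : ∀ c, |deriv φ c| ≤ L)
    (hφ2 : ∀ c c', |deriv φ c - deriv φ c'| ≤ L * |c - c'|)
    (hg1 : ∀ c, |g c| ≤ B) (hg2 : ∀ c c', |g c - g c'| ≤ B * |c - c'|)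
    {p d : ℕ} (hd : 0 < d) (V : Fin p → Fin d → ℝ) (ε : ℝ)
    (hV : ∀ z u y : Fin d → ℝ, dotp z z ≤ d → dotp u u ≤ d →
      dotp y y ≤ d → |AF (FB φ g) V z u y - EF (FB φ g) z u y| ≤ ε)
    (x w y : Fin d → ℝ) (hx : dotp x x ≤ d) (hx' : dotp (x + w) (x + w) ≤ d) (hy : dotp y y ≤ d) :
    |(AF (FA φ g) V 0 (x + w) y - EF (FA φ g) 0 (x + w) y)
      - (AF (FA φ g) V 0 x y - EF (FA φ g) 0 x y)| ≤ ε * √(dotp w w / d) := by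
  have hd' : (0:ℝ) < d := by exact_mod_cast hd
  have aA := adm_FA hL hB hφ0 hg1 hg2
  have aB := adm_FB hL hB hφ1 hφ2 hg1 hg2
  by_cases hw : dotp w w = 0
  · have := dotp_self_eq_zero w hw
    subst this
    simp [dotp]
  have hwpos : 0 < dotp w w := lt_of_le_of_ne (dotp_self_nonneg _) (Ne.symm hw)
  set r := √(dotp w w / d) with hr
  have hrpos : 0 < r := by positivity
  have hr2 : r ^ 2 = dotp w w / d := Real.sq_sqrt (by positivity)
  set u : Fin d → ℝ := r⁻¹ • w with hu
  have hwu : w = r • u := by rw [hu, smul_smul, mul_inv_cancel₀ hrpos.ne', one_smul]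
  have huu : dotp u u ≤ d := by
    have : dotp u u = d := by
      rw [hu, dotp_smul_right, dotp_comm, dotp_smul_right, ← mul_assoc]
      have : r⁻¹ * r⁻¹ = (r ^ 2)⁻¹ := by rw [sq, mul_inv]
      rw [this, hr2]
      field_simp
    exact this.le
  have hdv : ∀ (v : Fin d → ℝ) (s : ℝ), HasDerivAt
      (fun s => φ (dotp v (x + s • w)) * g (dotp v y))
      (FB φ g (dotp v (x + s • w)) (dotp v w) (dotp v y)) s := by
    intro v s
    have h1 : HasDerivAt (fun s : ℝ => dotp v (x + s • w)) (dotp v w) s := by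
      have e : (fun s : ℝ => dotp v (x + s • w)) = fun s => dotp v x + s * dotp v w := by
        ext s; rw [dotp_add_right, dotp_smul_right]
      rw [e]
      exact (hasDerivAt_mul_const (dotp v w)).const_add _
    exact ((hdiff _).hasDerivAt.comp s h1).mul_const _
  have hlin : ∀ a b c, FB φ g a (r * b) c = r * FB φ g a b c := by
    intro a b c; unfold FB; ring
  have hF : ∀ s ∈ Set.Icc (0:ℝ) 1, HasDerivAt (fun s : ℝ => AF (FA φ g) V 0 (x + s • w) y
      - EF (FA φ g) 0 (x + s • w) y)
      (r * (AF (FB φ g) V (x + s • w) u y - EF (FB φ g) (x + s • w) u y)) s := by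
    intro s hs
    rw [mul_sub]
    refine HasDerivAt.sub ?_ ?_
    · have h1 : HasDerivAt (fun s : ℝ => (p:ℝ)⁻¹ * ∑ k, φ (dotp (V k) (x + s • w)) * g (dotp (V k) y))
          ((p:ℝ)⁻¹ * ∑ k, FB φ g (dotp (V k) (x + s • w)) (dotp (V k) w) (dotp (V k) y)) s :=
        (HasDerivAt.fun_sum fun k _ => hdv (V k) s).const_mul _
      refine HasDerivAt.congr_deriv h1 ?_
      unfold AF
      rw [mul_left_comm, Finset.mul_sum _ _ r]
      refine congrArg _ (Finset.sum_congr rfl fun k _ => ?_)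
      conv_lhs => rw [hwu]
      rw [dotp_smul_right, hlin, ← hwu]
    · have hi : Integrable (fun v => L * B * |dotp v w|) (rowG d) :=
        ((rowG_dotp_gaussian d w).integrable.abs).const_mul _
      have hm : ∀ s : ℝ, Measurable (fun v : Fin d → ℝ => φ (dotp v (x + s • w)) * g (dotp v y)) :=
        fun s => aA.measurable 0 (x + s • w) y
      have hm2 : Measurable
          (fun v : Fin d → ℝ => FB φ g (dotp v (x + s • w)) (dotp v w) (dotp v y)) :=
        aB.measurable (x + s • w) w y
      have key := hasDerivAt_integral_of_dominated_loc_of_deriv_le (μ := rowG d) (𝕜 := ℝ)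
        (s := Set.univ) (x₀ := s)
        (F := fun s v => φ (dotp v (x + s • w)) * g (dotp v y))
        (F' := fun s v => FB φ g (dotp v (x + s • w)) (dotp v w) (dotp v y))
        (bound := fun v => L * B * |dotp v w|) Filter.univ_mem
        (Filter.Eventually.of_forall fun s => (hm s).aestronglyMeasurable)
        (aA.integrable hd 0 (x + s • w) y (ball_convex x w hx hx' s hs.1 hs.2))
        hm2.aestronglyMeasurable
        (by
          filter_upwards with v s _
          unfold FB
          rw [Real.norm_eq_abs, abs_mul, abs_mul]
          calc _ ≤ L * |dotp v w| * B := by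
                gcongr
                · exact hφ1 _
                · exact hg1 _
            _ = _ := by ring)
        hi
        (by
          filter_upwards with v s _
          exact hdv v s)
      refine HasDerivAt.congr_deriv key.2 ?_
      unfold EF
      rw [← integral_const_mul]
      congr 1; ext v
      conv_lhs => rw [hwu]
      rw [dotp_smul_right, hlin, ← hwu]
  have mv := norm_image_sub_le_of_norm_deriv_le_segment_01' (C := ε * r)
    (fun s hs => (hF s hs).hasDerivWithinAt) (by
      intro s hs
      rw [Real.norm_eq_abs, abs_mul, abs_of_pos hrpos, mul_comm]
      gcongr
      exact hV _ _ _ (ball_convex x w hx hx' s hs.1 hs.2.le) huu hy)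
  simp only [one_smul, zero_smul, add_zero] at mv
  exact mv

/-- the good event for one Hermite degree -/
def Good (φ g : ℝ → ℝ) (l : ℕ) (ε : ℝ) {p d : ℕ} (V : Fin p → Fin d → ℝ) : Prop :=
  ∀ x x' y : Fin d → ℝ, dotp x x = d → dotp x' x' = d → dotp y y = d →
    |(p:ℝ)⁻¹ * ∑ k, φ (dotp (V k) x) * g (dotp (V k) y)
      - hermiteCoeff φ l * (dotp x y / d) ^ l| ≤ ε ∧
    |(p:ℝ)⁻¹ * ∑ k, (φ (dotp (V k) x') - φ (dotp (V k) x)) * g (dotp (V k) y)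
      - hermiteCoeff φ l * ((dotp x' y / d) ^ l - (dotp x y / d) ^ l)|
      ≤ ε * √(dotp (x' - x) (x' - x) / d)

lemma good_event (φ : ℝ → ℝ) (hφ : ActivationAssumption φ) (p : ℕ → ℕ)
    (hp : Tendsto (fun d : ℕ => (p d : ℝ) / ((d : ℝ) * (Real.log d) ^ 2)) atTop atTop)
    (l : ℕ) (ε : ℝ) (hε : 0 < ε) : ∃ g : ℝ → ℝ,
    Negl (fun d => gaussianMatrix (p d) d {V | ¬ Good φ g l ε V}) := by
  obtain ⟨L0, hL0⟩ := hφ.lipschitz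
  obtain ⟨L1, hL1⟩ := hφ.deriv_lipschitz
  obtain ⟨g, B, hB, hg1, hg2, hpop⟩ := population φ L0 hL0 l (ε / 2) (by positivity)
  refine ⟨g, ?_⟩
  set L : ℝ := L0 + L1 with hL
  have p0 : (0:ℝ) ≤ L0 := L0.2
  have p1 : (0:ℝ) ≤ L1 := L1.2
  have hLn : 0 ≤ L := by positivity
  have hφ0 : ∀ c c', |φ c - φ c'| ≤ L * |c - c'| := by
    intro c c'
    have := hL0.dist_le_mul c c'
    rw [Real.dist_eq, Real.dist_eq] at this
    refine this.trans ?_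
    gcongr
    linarith
  have hφ1 : ∀ c, |deriv φ c| ≤ L := by
    intro c
    have := norm_deriv_le_of_lipschitz (x₀ := c) hL0
    rw [Real.norm_eq_abs] at this
    linarith
  have hφ2 : ∀ c c', |deriv φ c - deriv φ c'| ≤ L * |c - c'| := by
    intro c c'
    have := hL1.dist_le_mul c c'
    rw [Real.dist_eq, Real.dist_eq] at this
    refine this.trans ?_
    gcongr
    linarith
  have aA := adm_FA hLn hB hφ0 hg1 hg2
  have aB := adm_FB hLn hB hφ1 hφ2 hg1 hg2
  refine ((aA.uniform p hp (ε / 2) (by positivity)).add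
    (aB.uniform p hp (ε / 2) (by positivity))).mono ?_
  filter_upwards [eventually_gt_atTop 0] with d hd
  refine le_trans (measure_mono ?_) (measure_union_le _ _)
  intro V hV
  by_contra hcon
  rw [Set.mem_union, not_or] at hcon
  simp only [Set.mem_ofPred_eq, not_not] at hcon
  obtain ⟨h1, h2⟩ := hcon
  apply hV
  intro x x' y hx hx' hy
  obtain ⟨q1, q2⟩ := hpop d hd x x' y hx hx' hy
  have z0 : dotp (0 : Fin d → ℝ) 0 ≤ d := by simp [dotp]
  constructor
  · have := h1 0 x y z0 hx.le hy.le
    unfold AF EF FA at this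
    have h3 := abs_add_le _ _ |>.trans (add_le_add this q1)
    rw [sub_add_sub_cancel, add_halves] at h3
    exact h3
  · have hxw : x + (x' - x) = x' := by abel
    have := diff_bound hLn hB hφ.differentiable hφ0 hφ1 hφ2 hg1 hg2 hd V (ε / 2) h2 x (x' - x) y
      hx.le (by rw [hxw]; exact hx'.le) hy.le
    rw [hxw] at this
    have i1 := aA.integrable hd 0 x' y hx'.le
    have i2 := aA.integrable hd 0 x y hx.le
    unfold FA at i1 i2
    unfold AF EF FA at this
    simp only [sub_mul] at q2 ⊢
    rw [integral_sub i1 i2] at q2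
    have h3 := abs_add_le _ _ |>.trans (add_le_add this q2)
    rw [← add_mul, add_halves] at h3
    refine le_trans (le_of_eq ?_) h3
    congr 1
    rw [Finset.sum_sub_distrib]
    ring

lemma eNorm_eq_sqrt {m : ℕ} (x : Fin m → ℝ) : eNorm x = √(dotp x x) := by
  simp only [eNorm, dotp, sq]

lemma eNorm_iff {d : ℕ} (x : Fin d → ℝ) : eNorm x = √d ↔ dotp x x = d := by
  rw [eNorm_eq_sqrt, Real.sqrt_inj (dotp_self_nonneg x) (Nat.cast_nonneg d)]

lemma dotp_cs {m : ℕ} (u x : Fin m → ℝ) : dotp u x ^ 2 ≤ dotp u u * dotp x x := by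
  have := Finset.sum_mul_sq_le_sq_mul_sq Finset.univ u x
  simpa only [dotp, sq] using this

lemma subg_exists {d : ℕ} (hd : 0 < d) (P : Measure (Fin d → ℝ)) (K : ℝ) (h : DataAssumption P K)
    (u : Fin d → ℝ) (hu : eNorm u = 1) :
    ∃ t : ℝ, 0 < t ∧ t < K + 1 ∧ ∫ x, Real.exp ((dotp u x) ^ 2 / t ^ 2) ∂P ≤ 2 := by
  have := h.prob
  have hd' : (0:ℝ) < d := by exact_mod_cast hd
  have hlog : 0 < Real.log 2 := Real.log_pos (by norm_num)
  set T : ℝ := √(d / Real.log 2) with hT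
  have hTpos : 0 < T := by positivity
  have hmem : ∀ u : Fin d → ℝ, eNorm u = 1 →
      T ∈ {t : ℝ | 0 < t ∧ ∫ x, Real.exp ((dotp u x) ^ 2 / t ^ 2) ∂P ≤ 2} := by
    intro u hu
    refine ⟨hTpos, ?_⟩
    have hu2 : dotp u u = 1 := by
      rw [eNorm_eq_sqrt, Real.sqrt_eq_one] at hu; exact hu
    have hb : ∀ᵐ x ∂P, ‖Real.exp ((dotp u x) ^ 2 / T ^ 2)‖ ≤ 2 := by
      filter_upwards [h.norm_eq] with x hx
      rw [eNorm_iff] at hx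
      have h1 := dotp_cs u x
      rw [hu2, hx, one_mul] at h1
      rw [Real.norm_eq_abs, abs_of_pos (Real.exp_pos _), hT, Real.sq_sqrt (by positivity)]
      calc _ ≤ Real.exp (d / (d / Real.log 2)) := by gcongr
        _ = 2 := by rw [div_div_cancel₀ hd'.ne', Real.exp_log (by norm_num)]
    have := norm_integral_le_of_norm_le_const hb
    simp at this
    exact (le_abs_self _).trans this
  have hbb : ∀ u : Fin d → ℝ,
      BddBelow {t : ℝ | 0 < t ∧ ∫ x, Real.exp ((dotp u x) ^ 2 / t ^ 2) ∂P ≤ 2} :=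
    fun u => ⟨0, fun t ht => ht.1.le⟩
  have hba : BddAbove (Set.range fun u : {u : Fin d → ℝ // eNorm u = 1} =>
      sInf {t : ℝ | 0 < t ∧ ∫ x, Real.exp ((dotp u.1 x) ^ 2 / t ^ 2) ∂P ≤ 2}) := by
    refine ⟨T, ?_⟩
    rintro _ ⟨u, rfl⟩
    exact csInf_le (hbb u.1) (hmem u.1 u.2)
  have h1 := (le_ciSup hba ⟨u, hu⟩).trans h.subg
  obtain ⟨t, ht, htK⟩ := exists_lt_of_csInf_lt ⟨T, hmem u hu⟩ (lt_of_le_of_lt h1 (lt_add_one K))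
  exact ⟨t, ht.1, htK, ht.2⟩

lemma single_tail {d : ℕ} (hd : 0 < d) (P : Measure (Fin d → ℝ)) (K : ℝ) (h : DataAssumption P K)
    (y : Fin d → ℝ) (hy : eNorm y = √d) (ε : ℝ) (hε : 0 < ε) :
    P {x | ε * d < |dotp y x|} ≤ ENNReal.ofReal (2 * Real.exp (- (ε ^ 2 / (K + 1) ^ 2 * d))) := by
  have := h.prob
  have hd' : (0:ℝ) < d := by exact_mod_cast hd
  have hsd : 0 < √(d:ℝ) := by positivity
  rw [eNorm_iff] at hy
  set u : Fin d → ℝ := (√(d:ℝ))⁻¹ • y with hu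
  have hu1 : dotp u u = 1 := by
    rw [hu, dotp_smul_right, dotp_comm, dotp_smul_right, hy]
    have := Real.mul_self_sqrt hd'.le
    field_simp
    rw [sq, this]
  have hyu : ∀ x, dotp y x = √d * dotp u x := by
    intro x
    rw [dotp_comm u, hu, dotp_smul_right, dotp_comm x, ← mul_assoc, mul_inv_cancel₀ hsd.ne', one_mul]
  obtain ⟨t, ht0, htK, hInt⟩ := subg_exists hd P K h u (by rw [eNorm_eq_sqrt, hu1, Real.sqrt_one])
  have hI : Integrable (fun x => Real.exp ((dotp u x) ^ 2 / t ^ 2)) P := by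
    refine Integrable.of_bound (C := Real.exp (d / t ^ 2)) ?_ ?_
    · have : Continuous fun x => dotp u x := by simp only [dotp_comm u]; fun_prop
      exact (by fun_prop : Continuous fun x => Real.exp ((dotp u x) ^ 2 / t ^ 2)).aestronglyMeasurable
    · filter_upwards [h.norm_eq] with x hx
      rw [eNorm_iff] at hx
      have h1 := dotp_cs u x
      rw [hu1, hx, one_mul] at h1
      rw [Real.norm_eq_abs, abs_of_pos (Real.exp_pos _)]
      gcongr
  have mk := mul_meas_ge_le_integral_of_nonneg
    (Filter.Eventually.of_forall fun x => (Real.exp_pos _).le) hI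
    (Real.exp (ε ^ 2 / (K + 1) ^ 2 * d))
  have hsub : {x : Fin d → ℝ | ε * d < |dotp y x|}
      ⊆ {x | Real.exp (ε ^ 2 / (K + 1) ^ 2 * d) ≤ Real.exp ((dotp u x) ^ 2 / t ^ 2)} := by
    intro x hx
    simp only [Set.mem_ofPred_eq] at hx ⊢
    rw [hyu, abs_mul, abs_of_pos hsd] at hx
    have h2 : ε * √d ≤ |dotp u x| := by
      have : √d * (ε * √d) < √d * |dotp u x| := by
        have e := Real.mul_self_sqrt hd'.le
        nlinarith
      exact (lt_of_mul_lt_mul_left this hsd.le).le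
    have h3 : ε ^ 2 * d ≤ dotp u x ^ 2 := by
      have := pow_le_pow_left₀ (by positivity) h2 2
      rw [mul_pow, Real.sq_sqrt hd'.le, sq_abs] at this
      exact this
    apply Real.exp_le_exp.mpr
    rw [div_mul_eq_mul_div]
    gcongr
  refine (measure_mono hsub).trans ?_
  rw [← ofReal_measureReal]
  apply ENNReal.ofReal_le_ofReal
  rw [Real.exp_neg, mul_comm 2, le_inv_mul_iff₀ (Real.exp_pos _)]
  exact mk.trans hInt

lemma data_event (P : (d : ℕ) → Measure (Fin d → ℝ)) (K : ℝ)
    (hdata : ∀ d, DataAssumption (P d) K) (ε : ℝ) (hε : 0 < ε) :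
    Negl (fun d => (Measure.pi fun _ : Fin 2 => P d) {X | ¬ ((∀ i, dotp (X i) (X i) = d) ∧
      |dotp (X 0) (X 1)| ≤ ε * d)}) := by
  have hK : 0 < K + 1 := by
    obtain ⟨t, h0, h1, _⟩ := subg_exists (d := 1) one_pos (P 1) K (hdata 1) (fun _ => 1)
      (by simp [eNorm])
    linarith
  set c := ε ^ 2 / (K + 1) ^ 2 with hc
  have hcpos : 0 < c := by positivity
  have hneg : Negl (fun d => ENNReal.ofReal (2 * Real.exp (- (c * d)))) := by
    intro k hk
    have hlo := (Real.isLittleO_log_id_atTop.def (show 0 < c / (2 * k) by positivity))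
    filter_upwards [tendsto_natCast_atTop_atTop.eventually hlo, eventually_gt_atTop 0,
      tendsto_natCast_atTop_atTop.eventually_ge_atTop (2 / c)] with d h1 h2 h3
    have hd' : (0:ℝ) < d := by exact_mod_cast h2
    apply ENNReal.ofReal_le_ofReal
    rw [id, Real.norm_eq_abs, Real.norm_eq_abs, abs_of_pos hd'] at h1
    have h4 := (le_abs_self _).trans h1
    rw [div_le_iff₀ hcpos] at h3
    rw [div_mul_eq_mul_div, le_div_iff₀ (by positivity)] at h4
    rw [Real.rpow_def_of_pos hd']
    have e2 : (2:ℝ) ≤ Real.exp 1 := by linarith [Real.add_one_le_exp (1:ℝ)]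
    calc 2 * Real.exp (- (c * d)) ≤ Real.exp 1 * Real.exp (- (c * d)) := by gcongr
      _ = Real.exp (1 + - (c * d)) := by rw [Real.exp_add]
      _ ≤ _ := by
        gcongr
        nlinarith
  refine hneg.mono ?_
  filter_upwards [eventually_gt_atTop 0] with d hd
  have hpr := (hdata d).prob
  have hae : ∀ i : Fin 2, ∀ᵐ X ∂(Measure.pi fun _ : Fin 2 => P d), dotp (X i) (X i) = d := by
    intro i
    have h1 : ∀ᵐ x ∂(P d), dotp x x = d := by
      filter_upwards [(hdata d).norm_eq] with x hx
      exact (eNorm_iff x).mp hx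
    exact (measurePreserving_eval (fun _ : Fin 2 => P d) i).quasiMeasurePreserving.ae h1
  have hall := ae_all_iff.mpr hae
  set A : Set ((Fin d → ℝ) × (Fin d → ℝ)) := {q | ε * d < |dotp q.1 q.2|} with hA
  have hAm : MeasurableSet A := by
    have : Continuous fun q : (Fin d → ℝ) × (Fin d → ℝ) => |dotp q.1 q.2| := by
      unfold dotp; fun_prop
    exact measurableSet_lt measurable_const this.measurable
  have hmp := measurePreserving_finTwoArrow (P d)
  have hle : (Measure.pi fun _ : Fin 2 => P d) {X | ¬ ((∀ i, dotp (X i) (X i) = d) ∧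
      |dotp (X 0) (X 1)| ≤ ε * d)}
      ≤ (Measure.pi fun _ : Fin 2 => P d) (MeasurableEquiv.finTwoArrow ⁻¹' A) := by
    refine measure_mono_ae ?_
    filter_upwards [hall] with X hX hbad
    have : ¬ |dotp (X 0) (X 1)| ≤ ε * d := fun h => hbad ⟨hX, h⟩
    rw [not_le] at this
    exact this
  refine hle.trans ?_
  rw [hmp.measure_preimage hAm.nullMeasurableSet, Measure.prod_apply hAm]
  calc _ ≤ ∫⁻ _, ENNReal.ofReal (2 * Real.exp (- (c * d))) ∂(P d) := by
        refine lintegral_mono_ae ?_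
        filter_upwards [(hdata d).norm_eq] with x hx
        exact single_tail hd (P d) K (hdata d) x hx ε hε
    _ = _ := by simp

/-- rescaling from the unit sphere to the sphere of radius `√d` -/
def upS {d : ℕ} (x : EuclideanSpace ℝ (Fin d)) : Fin d → ℝ := √(d:ℝ) • x.ofLp

/-- rescaling from the sphere of radius `√d` to the unit sphere -/
def dnS {d : ℕ} (x : Fin d → ℝ) : EuclideanSpace ℝ (Fin d) := WithLp.toLp 2 ((√(d:ℝ))⁻¹ • x)

lemma inner_eq_dotp {d : ℕ} (x y : EuclideanSpace ℝ (Fin d)) :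
    inner ℝ x y = dotp x.ofLp y.ofLp := by
  simp [PiLp.inner_apply, dotp, mul_comm]

lemma dotp_upS {d : ℕ} (x y : EuclideanSpace ℝ (Fin d)) :
    dotp (upS x) (upS y) = d * inner ℝ x y := by
  rw [upS, upS, dotp_smul_right, dotp_comm, dotp_smul_right, inner_eq_dotp, ← mul_assoc,
    Real.mul_self_sqrt (Nat.cast_nonneg d), dotp_comm]

lemma upS_dnS {d : ℕ} (hd : 0 < d) (x : Fin d → ℝ) : upS (dnS x) = x := by
  have h : √(d:ℝ) ≠ 0 := by positivity
  simp [upS, dnS, smul_smul, h]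

lemma upS_sub {d : ℕ} (x y : EuclideanSpace ℝ (Fin d)) : upS (x - y) = upS x - upS y := by
  simp [upS, smul_sub]

lemma dnS_sub {d : ℕ} (x y : Fin d → ℝ) : dnS (x - y) = dnS x - dnS y := by
  simp [dnS, smul_sub]

lemma norm_upS {d : ℕ} (hd : 0 < d) (x : EuclideanSpace ℝ (Fin d)) :
    ‖x‖ = √(dotp (upS x) (upS x) / d) := by
  have h : (d:ℝ) ≠ 0 := by positivity
  rw [dotp_upS, mul_div_cancel_left₀ _ h, real_inner_self_eq_norm_sq, Real.sqrt_sq (norm_nonneg _)]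

/-- test functional -/
def testF {p d : ℕ} (φ : ℝ → ℝ) (V : Fin p → Fin d → ℝ) (G : ℕ → ℝ → ℝ) (m : ℕ)
    (y : EuclideanSpace ℝ (Fin d)) : (Fin p → ℝ) →ₗ[ℝ] ℝ :=
  ((hermiteCoeff φ m)⁻¹ * (p:ℝ)⁻¹) • ∑ k, G m (dotp (V k) (upS y)) • LinearMap.proj k

lemma testF_apply {p d : ℕ} (φ : ℝ → ℝ) (V : Fin p → Fin d → ℝ) (G : ℕ → ℝ → ℝ) (m : ℕ)
    (y : EuclideanSpace ℝ (Fin d)) (f : Fin p → ℝ) : testF φ V G m y f =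
      (hermiteCoeff φ m)⁻¹ * ((p:ℝ)⁻¹ * ∑ k, f k * G m (dotp (V k) (upS y))) := by
  simp only [testF, LinearMap.smul_apply, LinearMap.sum_apply, LinearMap.proj_apply, smul_eq_mul,
    mul_assoc, mul_comm (f _)]

lemma normalize_bound (μ S a b : ℝ) (hμ : μ ≠ 0) (h : |S - μ * a| ≤ b * |μ|) :
    |μ⁻¹ * S - a| ≤ b := by
  have h' : 0 < |μ| := abs_pos.mpr hμ
  have : μ⁻¹ * S - a = μ⁻¹ * (S - μ * a) := by field_simp
  rw [this, abs_mul, abs_inv, inv_mul_le_iff₀ h']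
  linarith

lemma det_step {p d : ℕ} (hd : 0 < d) (φ : ℝ → ℝ) (V : Fin p → Fin d → ℝ) (G : ℕ → ℝ → ℝ)
    (ε η : ℝ) (hε : 0 ≤ ε) (hη : 0 ≤ η)
    (l l' : ℕ) (hl : 3 ≤ l) (hl' : 3 ≤ l') (hpar : l % 2 ≠ l' % 2)
    (hε' : ε ≤ 1/100) (hη' : η ≤ 1/100)
    (hεl : l * ε ≤ 1 / 100) (hηl : l * η ≤ 1 / 100) (hεη : 80 * ε ≤ η ^ 2)
    (hμ : ∀ m, m = 1 ∨ m = l ∨ m = l' → hermiteCoeff φ m ≠ 0)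
    (hG : ∀ m, m = 1 ∨ m = l ∨ m = l' → Good φ (G m) m (ε * |hermiteCoeff φ m|) V)
    (X : Fin 2 → Fin d → ℝ) (hX : ∀ i, dotp (X i) (X i) = d)
    (h12 : |dotp (X 0) (X 1)| ≤ ε * d)
    (Z : Fin 2 → Fin d → ℝ) (hZ : ∀ i, eNorm (Z i) = √d)
    (hspan : ∀ i, featureMap φ V (X i) ∈
      Submodule.span ℝ (Set.range fun j => featureMap φ V (Z j))) :
    ∀ i, ∃ j, eNorm (Z j - X i) ≤ η * √d := by
  have hd' : (0:ℝ) < d := by positivity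
  have hn : ∀ x : EuclideanSpace ℝ (Fin d), ‖x‖ = 1 → dotp (upS x) (upS x) = d := by
    intro x hx
    rw [dotp_upS, real_inner_self_eq_norm_sq, hx]; ring
  have hi : ∀ x y : EuclideanSpace ℝ (Fin d), dotp (upS x) (upS y) / d = inner ℝ x y := by
    intro x y
    rw [dotp_upS, mul_div_cancel_left₀ _ hd'.ne']
  have hdn : ∀ x : Fin d → ℝ, dotp x x = d → ‖dnS x‖ = 1 := by
    intro x hx
    rw [norm_upS hd, upS_dnS hd, hx, div_self hd'.ne', Real.sqrt_one]
  have key := det_reconstruct (fun x => featureMap φ V (upS x)) (testF φ V G) ε η hε hη l l' hl hl'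
    hpar hε' hη' hεl hηl hεη ?_ ?_ (fun i => dnS (X i)) (fun i => hdn _ (hX i)) ?_
    (fun i => dnS (Z i)) (fun i => hdn _ ((eNorm_iff _).1 (hZ i))) ?_
  · intro i
    obtain ⟨j, hj⟩ := key i
    refine ⟨j, ?_⟩
    rw [← dnS_sub, norm_upS hd, upS_dnS hd, Real.sqrt_div' _ hd'.le,
      div_le_iff₀ (Real.sqrt_pos.2 hd'), ← eNorm_eq_sqrt] at hj
    exact hj
  · intro m hm x y hx hy
    have h := (hG m hm _ _ _ (hn x hx) (hn x hx) (hn y hy)).1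
    rw [testF_apply]
    apply normalize_bound _ _ _ _ (hμ m hm)
    rw [hi] at h
    exact h
  · intro m hm x x' y hx hx' hy
    have h := (hG m hm _ _ _ (hn x hx) (hn x' hx') (hn y hy)).2
    rw [testF_apply]
    apply normalize_bound _ _ _ _ (hμ m hm)
    rw [hi, hi, ← upS_sub, ← norm_upS hd] at h
    rw [mul_right_comm]
    exact h
  · rw [← hi, upS_dnS hd, upS_dnS hd, abs_div, abs_of_pos hd', div_le_iff₀ hd']
    exact h12
  · intro i
    simp only [upS_dnS hd]
    exact hspan i

/-- **Theorem 2 (Full reconstruction for `n = 2`).**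
Under the random features setup and the data, activation, and scaling assumptions with
`n = 2`: for every `η > 0` and `k > 0` there exists `D` such that for all `d ≥ D`, with
probability at least `1 − d^{−k}` over `V` and the data `(x₁, x₂)`, every `X̂` with rows of
norm `√d` whose feature span contains both training features reconstructs *both* samples:
for every `i` there is a row `ĵ` of `X̂` with `‖x̂_ĵ − x_i‖₂ ≤ η √d`. -/
theorem full_reconstruction_n_two
    (φ : ℝ → ℝ) (hφ : ActivationAssumption φ)
    (K : ℝ)
    (p : ℕ → ℕ)
    (P : (d : ℕ) → Measure (Fin d → ℝ))
    (hdata : ∀ d, DataAssumption (P d) K)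
    (hp : Tendsto (fun d : ℕ => (p d : ℝ) / ((d : ℝ) * (Real.log d) ^ 2)) atTop atTop) :
    ∀ η : ℝ, 0 < η → ∀ k : ℝ, 0 < k → ∃ D : ℕ, ∀ d : ℕ, D ≤ d →
      1 - ENNReal.ofReal ((d : ℝ) ^ (-k)) ≤
        ((gaussianMatrix (p d) d).prod (Measure.pi fun _ : Fin 2 => P d))
          {ω | ∀ Xh : Fin 2 → Fin d → ℝ,
              (∀ j, eNorm (Xh j) = Real.sqrt d) →
              (∀ i, featureMap φ ω.1 (ω.2 i) ∈
                Submodule.span ℝ (Set.range fun j => featureMap φ ω.1 (Xh j))) →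
              ∀ i : Fin 2, ∃ jh : Fin 2,
                eNorm (Xh jh - ω.2 i) ≤ η * Real.sqrt d} := by
  intro η hη k hk
  obtain ⟨l, l', hl, hl', hpar, hμl, hμl'⟩ := hφ.parity
  have hμ1 := hφ.mu1
  have hl0 : (3:ℝ) ≤ l := by exact_mod_cast hl
  obtain ⟨η', hη'0, hη'1, hη'2⟩ : ∃ η' : ℝ, 0 < η' ∧ η' ≤ η ∧ l * η' ≤ 1 / 100 := by
    refine ⟨min η (1 / 100 / l), by positivity, min_le_left _ _, ?_⟩
    calc (l:ℝ) * min η (1 / 100 / l) ≤ l * (1 / 100 / l) := by gcongr; exact min_le_right _ _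
      _ = 1 / 100 := by field_simp
  obtain ⟨ε, hε0, hε1, hε2⟩ : ∃ ε : ℝ, 0 < ε ∧ 80 * ε ≤ η' ^ 2 ∧ l * ε ≤ 1 / 100 := by
    refine ⟨min (η' ^ 2 / 80) (1 / 100 / l), by positivity, ?_, ?_⟩
    · linarith [min_le_left (η' ^ 2 / 80) (1 / 100 / (l:ℝ))]
    calc (l:ℝ) * min (η' ^ 2 / 80) (1 / 100 / (l:ℝ)) ≤ l * (1 / 100 / l) := by
          gcongr; exact min_le_right _ _
      _ = 1 / 100 := by field_simp
  have hη'3 : η' ≤ 1 / 100 := by nlinarith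
  have hε3 : ε ≤ 1 / 100 := by nlinarith
  have hμ : ∀ m, m = 1 ∨ m = l ∨ m = l' → hermiteCoeff φ m ≠ 0 := by
    rintro m (rfl | rfl | rfl) <;> assumption
  have hex : ∀ m, ∃ g : ℝ → ℝ, (m = 1 ∨ m = l ∨ m = l') →
      Negl (fun d => gaussianMatrix (p d) d {V | ¬ Good φ g m (ε * |hermiteCoeff φ m|) V}) := by
    intro m
    by_cases hm : m = 1 ∨ m = l ∨ m = l'
    · obtain ⟨g, hg⟩ := good_event φ hφ p hp m (ε * |hermiteCoeff φ m|)
        (mul_pos hε0 (abs_pos.mpr (hμ m hm)))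
      exact ⟨g, fun _ => hg⟩
    · exact ⟨id, fun h => absurd h hm⟩
  choose G hG using hex
  have hN := (((hG 1 (by tauto)).add (hG l (by tauto))).add (hG l' (by tauto))).add
    (data_event P K hdata ε hε0)
  obtain ⟨D, hD⟩ := eventually_atTop.1 ((hN k hk).and (eventually_gt_atTop 0))
  refine ⟨D, fun d hdD => ?_⟩
  obtain ⟨hb, hd⟩ := hD d hdD
  have : IsProbabilityMeasure (P d) := (hdata d).prob
  set μ := gaussianMatrix (p d) d with hμdef
  set ν := Measure.pi fun _ : Fin 2 => P d with hνdef
  have hcov : ∀ S : Set ((Fin (p d) → Fin d → ℝ) × (Fin 2 → Fin d → ℝ)),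
      (∀ ω, (∀ m, m = 1 ∨ m = l ∨ m = l' → Good φ (G m) m (ε * |hermiteCoeff φ m|) ω.1) →
        ((∀ i, dotp (ω.2 i) (ω.2 i) = d) ∧ |dotp (ω.2 0) (ω.2 1)| ≤ ε * d) → ω ∈ S) →
      1 - ENNReal.ofReal ((d : ℝ) ^ (-k)) ≤ μ.prod ν S := by
    intro S hS
    have hpr : ∀ A : Set (Fin (p d) → Fin d → ℝ), μ.prod ν (A ×ˢ Set.univ) = μ A := by
      intro A; rw [Measure.prod_prod, measure_univ, mul_one]
    have hpr2 : ∀ A : Set (Fin 2 → Fin d → ℝ), μ.prod ν (Set.univ ×ˢ A) = ν A := by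
      intro A; rw [Measure.prod_prod, measure_univ, one_mul]
    rw [tsub_le_iff_right]
    set B : ℕ → Set (Fin (p d) → Fin d → ℝ) :=
      fun m => {V | ¬ Good φ (G m) m (ε * |hermiteCoeff φ m|) V} with hB
    set C : Set (Fin 2 → Fin d → ℝ) :=
      {X | ¬ ((∀ i, dotp (X i) (X i) = d) ∧ |dotp (X 0) (X 1)| ≤ ε * d)} with hC
    have hsub : (Set.univ : Set ((Fin (p d) → Fin d → ℝ) × (Fin 2 → Fin d → ℝ))) ⊆
        S ∪ (((B 1 ×ˢ Set.univ) ∪ (B l ×ˢ Set.univ) ∪ (B l' ×ˢ Set.univ)) ∪ Set.univ ×ˢ C) := by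
      intro ω _
      by_contra hcon
      simp only [Set.mem_union, Set.mem_prod, Set.mem_univ, and_true, true_and, not_or, hB, hC,
        Set.mem_ofPred_eq, not_not] at hcon
      obtain ⟨h1, ⟨⟨h2, h3⟩, h4⟩, h5⟩ := hcon
      refine h1 (hS ω ?_ h5)
      rintro m (rfl | rfl | rfl) <;> assumption
    calc (1:ENNReal) = μ.prod ν Set.univ := by rw [measure_univ]
      _ ≤ _ := measure_mono hsub
      _ ≤ _ := measure_union_le _ _
      _ ≤ μ.prod ν S + (μ (B 1) + μ (B l) + μ (B l') + ν C) := by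
          gcongr
          rw [← hpr, ← hpr, ← hpr, ← hpr2]
          refine (measure_union_le _ _).trans ?_
          gcongr
          refine (measure_union_le _ _).trans ?_
          gcongr
          exact measure_union_le _ _
      _ ≤ _ := by gcongr
  apply hcov
  intro ω h1 h2 Xh hXh hspan i
  obtain ⟨j, hj⟩ := det_step hd φ ω.1 G ε η' hε0.le hη'0.le l l' hl hl' hpar hε3 hη'3 hε2 hη'2 hε1
    hμ h1 ω.2 h2.1 h2.2 Xh hXh hspan i
  exact ⟨j, hj.trans (by gcongr)⟩
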